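/- Under conditions (B1)–(B4), √k (log Ẑ_{(k)} − log b*(n/k)) converges in distribution, as n → ∞, to a centered normal distribution with variance α^{−2}, where Ẑ_{(k)} is the k-th largest among the absolute residuals Ẑ_1,…,Ẑ_n. -/

import Mathlib

open MeasureTheory ProbabilityTheory Filter Set
open scoped ProbabilityTheory

noncomputable section

namespace TailCusum

variable {Ω : Type*} [MeasureSpace Ω]

/-- `φ₁(x) = 1{x > 0}`. -/
def phi1 (x : ℝ) : ℝ := if 0 < x then 1 else 0

/-- `φ₂(x) = x₊ = max {x, 0}`. -/
def phi2 (x : ℝ) : ℝ := max x 0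

/-- positive part -/
def pos (x : ℝ) : ℝ := max x 0

/-- A positive measurable function `g` is regularly varying at `∞` with index `ρ` if
`g(λ x)/g(x) → λ^ρ` as `x → ∞` for every `λ > 0`. -/
def RegularlyVarying (g : ℝ → ℝ) (ρ : ℝ) : Prop :=
  Measurable g ∧ ∀ lam : ℝ, 0 < lam →
    Tendsto (fun x => g (lam * x) / g x) atTop (nhds (lam ^ ρ))

/-- `l` is slowly varying at `∞`. -/
def SlowlyVarying (l : ℝ → ℝ) : Prop :=
  Measurable l ∧ ∀ lam : ℝ, 0 < lam →
    Tendsto (fun x => l (lam * x) / l x) atTop (nhds 1)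

/-- `κ(λ) = K ∫_1^λ t^(γ-1) dt`. -/
def kappaFun (K γ : ℝ) (lam : ℝ) : ℝ := K * ∫ t in (1:ℝ)..lam, t ^ (γ - 1)

/-- Second-order regular variation condition on the slowly varying function `l`
(the core of condition (A2)): `(l(λx)/l(x) - 1)/g(x) → κ(λ)` with
`κ(λ) = K ∫_1^λ t^(γ-1) dt`, `g` positive and regularly varying with index `γ ≤ 0`. -/
def SecondOrderRV (l g : ℝ → ℝ) (K γ : ℝ) : Prop :=
  γ ≤ 0 ∧ (∀ x, 0 < g x) ∧ RegularlyVarying g γ ∧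
  ∀ lam : ℝ, 0 < lam →
    Tendsto (fun x => (l (lam * x) / l x - 1) / g x) atTop (nhds (kappaFun K γ lam))

/-- distribution function of a law on `ℝ` -/
def df (μ : Measure ℝ) (x : ℝ) : ℝ := (μ (Iic x)).toReal

/-- tail distribution function `F̄(x) = μ(x, ∞)` -/
def tailDF (μ : Measure ℝ) (x : ℝ) : ℝ := (μ (Ioi x)).toReal

/-- the quantile-type function `b(x) = inf {y : F(y) ≥ 1 - x⁻¹}` -/
def quantileB (μ : Measure ℝ) (x : ℝ) : ℝ := sInf {y : ℝ | 1 - x⁻¹ ≤ df μ y}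

/-- `F̄(x) = x^(-α) l(x)` for `x > 0` with `l` slowly varying: Pareto-type tail. -/
def ParetoTail (μ : Measure ℝ) (α : ℝ) (l : ℝ → ℝ) : Prop :=
  SlowlyVarying l ∧ ∀ x : ℝ, 0 < x → tailDF μ x = x ^ (-α) * l x

/-- strict stationarity of a sequence of random variables -/
def IsStationary (X : ℕ → Ω → ℝ) : Prop :=
  ∀ j : ℕ,
    Measure.map (fun ω => fun i : ℕ => X (i + j) ω) (ℙ : Measure Ω)
      = Measure.map (fun ω => fun i : ℕ => X i ω) (ℙ : Measure Ω)

/-- strict stationarity, `ℤ`-indexed -/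
def IsStationaryZ (X : ℤ → Ω → ℝ) : Prop :=
  ∀ j : ℤ,
    Measure.map (fun ω => fun i : ℤ => X (i + j) ω) (ℙ : Measure Ω)
      = Measure.map (fun ω => fun i : ℤ => X i ω) (ℙ : Measure Ω)

/-- The β-mixing coefficient of the sequence `X` at lag `lag`, expressed as
the supremum over `m` of the total-variation distance between the joint law of
`(X_1, …, X_m)` and `(X_{m+lag+1}, X_{m+lag+2}, …)` and the product of the two laws. -/
def betaMix (X : ℕ → Ω → ℝ) (lag : ℕ) : ℝ :=
  ⨆ m : ℕ, ⨆ S : Subtype (MeasurableSet : Set ((Fin m → ℝ) × (ℕ → ℝ)) → Prop),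
    |((Measure.map
        (fun ω => ((fun i : Fin m => X ((i : ℕ) + 1) ω, fun i : ℕ => X (m + lag + 1 + i) ω)))
        (ℙ : Measure Ω)) S.1).toReal
      - (((Measure.map (fun ω => fun i : Fin m => X ((i : ℕ) + 1) ω) (ℙ : Measure Ω)).prod
          (Measure.map (fun ω => fun i : ℕ => X (m + lag + 1 + i) ω) (ℙ : Measure Ω))) S.1).toReal|

/-- The tail sample fraction condition: `k → ∞` and `k = o(n)`. -/
def TailFraction (k : ℕ → ℕ) : Prop :=
  Tendsto (fun n : ℕ => (k n : ℝ)) atTop atTop ∧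
    Tendsto (fun n : ℕ => (k n : ℝ) / n) atTop (nhds 0)

/-- Condition (A1): `(n / r_n) β([ε r_n]) → 0` for every `ε > 0`, and `r_n² = o(k)`. -/
def CondA1 (X : ℕ → Ω → ℝ) (k r : ℕ → ℕ) : Prop :=
  (∀ n, 0 < r n) ∧
  (∀ ε : ℝ, 0 < ε →
    Tendsto (fun n : ℕ => ((n : ℝ) / r n) * betaMix X ⌊ε * r n⌋₊) atTop (nhds 0)) ∧
  Tendsto (fun n : ℕ => ((r n : ℝ) ^ 2 / k n)) atTop (nhds 0)

/-- Condition (A2): second-order regular variation of `l` plus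
`√k · g(b(n/k)) → A ∈ ℝ`. -/
def CondA2 (l g : ℝ → ℝ) (K γ A : ℝ) (b : ℝ → ℝ) (k : ℕ → ℕ) : Prop :=
  SecondOrderRV l g K γ ∧
    Tendsto (fun n : ℕ => Real.sqrt (k n) * g (b ((n : ℝ) / k n))) atTop (nhds A)

/-- covariance of two real random variables -/
def cov (f g : Ω → ℝ) : ℝ :=
  ∫ ω, (f ω - ∫ ω', f ω') * (g ω - ∫ ω', g ω')

/-- pairs `1 ≤ i < j ≤ N` -/
def pairsUpTo (N : ℕ) : Finset (ℕ × ℕ) :=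
  ((Finset.Icc 1 N) ×ˢ (Finset.Icc 1 N)).filter fun p => p.1 < p.2

/-- Condition (A3): existence of the limits `χ` and `ω` of the normalized sums of
covariances, for every `0 < ε < 1`. -/
def CondA3 (X : ℕ → Ω → ℝ) (b : ℝ → ℝ) (k r : ℕ → ℕ) (α χ ωc : ℝ) : Prop :=
  0 ≤ χ ∧ 0 ≤ ωc ∧
  ∀ ε : ℝ, 0 < ε → ε < 1 →
    (Tendsto (fun n : ℕ =>
        (2 * α ^ 2 * n / ((⌊ε * r n⌋₊ : ℝ) * k n)) *
          ∑ p ∈ pairsUpTo ⌊ε * r n⌋₊,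
            cov (fun ω => pos (Real.log (X p.1 ω) - Real.log (b ((n : ℝ) / k n))))
                (fun ω => pos (Real.log (X p.2 ω) - Real.log (b ((n : ℝ) / k n)))))
      atTop (nhds χ)) ∧
    (Tendsto (fun n : ℕ =>
        (2 * (n : ℝ) / ((⌊ε * r n⌋₊ : ℝ) * k n)) *
          ∑ p ∈ pairsUpTo ⌊ε * r n⌋₊,
            cov (fun ω => if b ((n : ℝ) / k n) < X p.1 ω then (1 : ℝ) else 0)
                (fun ω => if b ((n : ℝ) / k n) < X p.2 ω then (1 : ℝ) else 0))
      atTop (nhds ωc))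

/-- the `k`-th largest value among `X_1, …, X_n` -/
def orderStat (n k : ℕ) (X : ℕ → Ω → ℝ) (ω : Ω) : ℝ :=
  sInf {x : ℝ | ((Finset.Icc 1 n).filter fun i => x < X i ω).card < k}

/-- `|Σ_{i=1}^l Y_i - (l/n) Σ_{i=1}^n Y_i|` -/
def cusumAt (n : ℕ) (Y : ℕ → ℝ) (l : ℕ) : ℝ :=
  |∑ i ∈ Finset.Icc 1 l, Y i - ((l : ℝ) / n) * ∑ i ∈ Finset.Icc 1 n, Y i|

/-- The cusum statistic `T_n(φ)` with random threshold `X_(k)`. -/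
def cusum (n k : ℕ) (X : ℕ → Ω → ℝ) (φ : ℝ → ℝ) (ω : Ω) : ℝ :=
  (Real.sqrt k)⁻¹ *
    ⨆ l ∈ Finset.Icc 1 n,
      cusumAt n (fun i => φ (Real.log (X i ω) - Real.log (orderStat n k X ω))) l

/-- The cusum statistic with deterministic threshold `b(n/k)`. -/
def cusumDet (n k : ℕ) (X : ℕ → Ω → ℝ) (φ : ℝ → ℝ) (b : ℝ → ℝ) (ω : Ω) : ℝ :=
  (Real.sqrt k)⁻¹ *
    ⨆ l ∈ Finset.Icc 1 n,
      cusumAt n (fun i => φ (Real.log (X i ω) - Real.log (b ((n : ℝ) / k)))) l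

/-- convergence in distribution (weak convergence of laws) of real random variables to
a real random variable `Z` defined on a possibly different probability space -/
def TendstoInDist {Ω' : Type*} [MeasureSpace Ω'] (Y : ℕ → Ω → ℝ) (Z : Ω' → ℝ) : Prop :=
  ∀ f : ℝ → ℝ, Continuous f → (∃ C, ∀ x, |f x| ≤ C) →
    Tendsto (fun n : ℕ => ∫ ω, f (Y n ω)) atTop (nhds (∫ ω, f (Z ω)))

/-- convergence in distribution to a law `μ` on `ℝ` -/
def TendstoInLaw (Y : ℕ → Ω → ℝ) (μ : Measure ℝ) : Prop :=
  ∀ f : ℝ → ℝ, Continuous f → (∃ C, ∀ x, |f x| ≤ C) →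
    Tendsto (fun n : ℕ => ∫ ω, f (Y n ω)) atTop (nhds (∫ x, f x ∂μ))

/-- bounded in probability (`O_P(1)`) -/
def BddInProb (Y : ℕ → Ω → ℝ) : Prop :=
  ∀ ε : ℝ, 0 < ε → ∃ C : ℝ, ∀ᶠ n in atTop,
    ((ℙ : Measure Ω) {ω | C < |Y n ω|}).toReal < ε

/-- divergence to `+∞` in probability -/
def DivergesInProb (Y : ℕ → Ω → ℝ) : Prop :=
  ∀ C : ℝ, Tendsto (fun n : ℕ => ((ℙ : Measure Ω) {ω | Y n ω ≤ C}).toReal) atTop (nhds 0)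

/-- standard Brownian motion on `[0, ∞)` -/
structure IsStdBrownianMotion {Ω' : Type*} [MeasureSpace Ω'] (B : ℝ → Ω' → ℝ) : Prop where
  isProb : IsProbabilityMeasure (ℙ : Measure Ω')
  meas : ∀ t, Measurable (B t)
  start : ∀ᵐ ω ∂(ℙ : Measure Ω'), B 0 ω = 0
  gauss_incr : ∀ s t : ℝ, 0 ≤ s → s ≤ t →
    Measure.map (fun ω => B t ω - B s ω) (ℙ : Measure Ω')
      = gaussianReal 0 (Real.toNNReal (t - s))
  indep_incr : ∀ (n : ℕ) (ts : ℕ → ℝ), (∀ i, 0 ≤ ts i) → Monotone ts →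
    iIndepFun (m := fun _ => Real.measurableSpace)
      (fun i : Fin n => fun ω => B (ts ((i : ℕ) + 1)) ω - B (ts (i : ℕ)) ω)
      (ℙ : Measure Ω')

/-- `sup_{0 ≤ t ≤ 1} |B°(t)|` where `B°(t) = B(t) - t B(1)` is the Brownian bridge
associated with the Brownian motion `B` -/
def supAbsBrownianBridge {Ω' : Type*} [MeasureSpace Ω'] (B : ℝ → Ω' → ℝ) (ω : Ω') : ℝ :=
  ⨆ t : Icc (0 : ℝ) 1, |B (t : ℝ) ω - (t : ℝ) * B 1 ω|

/-- `A_i(ζ) = φ(log X_i - log b(n/k) + ζ/√k)` -/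
def An (X : ℕ → Ω → ℝ) (b : ℝ → ℝ) (φ : ℝ → ℝ) (n k : ℕ) (ζ : ℝ) (i : ℕ) (ω : Ω) : ℝ :=
  φ (Real.log (X i ω) - Real.log (b ((n : ℝ) / k)) + ζ / Real.sqrt k)

/-- the tail sequential process `M_n(t, ζ) = k^{-1/2} Σ_{i=1}^{[nt]} (A_i(ζ) - E A_1(ζ))` -/
def Mn (X : ℕ → Ω → ℝ) (b : ℝ → ℝ) (φ : ℝ → ℝ) (n k : ℕ) (t ζ : ℝ) (ω : Ω) : ℝ :=
  (Real.sqrt k)⁻¹ * ∑ i ∈ Finset.Icc 1 ⌊(n : ℝ) * t⌋₊,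
    (An X b φ n k ζ i ω - ∫ ω', An X b φ n k ζ 1 ω')

/-- residual `ξ̂_i = X_i - Σ_{j=1}^p φ̂_j X_{i-j}` of an AR(p) fit -/
def residual (p : ℕ) (X : ℤ → Ω → ℝ) (φh : Ω → Fin p → ℝ) (i : ℕ) (ω : Ω) : ℝ :=
  X i ω - ∑ j : Fin p, φh ω j * X ((i : ℤ) - ((j : ℕ) + 1)) ω

/-- absolute residual `Ẑ_i = |ξ̂_i|` -/
def Zhat (p : ℕ) (X : ℤ → Ω → ℝ) (φh : Ω → Fin p → ℝ) (i : ℕ) (ω : Ω) : ℝ :=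
  |residual p X φh i ω|

/-- stationarity of the restriction of `Y` to the segment of indices `[a, b]` -/
def SegStationary (a b : ℕ) (Y : ℕ → Ω → ℝ) : Prop :=
  ∀ (m : ℕ) (s : Fin m → ℕ) (j : ℕ), (∀ q, a ≤ s q ∧ s q + j ≤ b) →
    Measure.map (fun ω => fun q : Fin m => Y (s q + j) ω) (ℙ : Measure Ω)
      = Measure.map (fun ω => fun q : Fin m => Y (s q) ω) (ℙ : Measure Ω)

/-- the row-wise mixing coefficient
`β_n(l) = sup_m sup {|P(A∩B) - P(A)P(B)| : A ∈ σ(Y_i : m+l+1 ≤ i ≤ n), B ∈ σ(Y_1,…,Y_m)}` -/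
def betaMixRow (n : ℕ) (Y : ℕ → Ω → ℝ) (lag : ℕ) : ℝ :=
  ⨆ m : ℕ, ⨆ As : Subtype (MeasurableSet : Set (Fin (n - (m + lag)) → ℝ) → Prop),
    ⨆ Bs : Subtype (MeasurableSet : Set (Fin m → ℝ) → Prop),
      |((ℙ : Measure Ω)
          (((fun ω => fun i : Fin (n - (m + lag)) => Y (m + lag + 1 + (i : ℕ)) ω) ⁻¹' As.1)
            ∩ ((fun ω => fun i : Fin m => Y ((i : ℕ) + 1) ω) ⁻¹' Bs.1))).toReal
        - ((ℙ : Measure Ω)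
            ((fun ω => fun i : Fin (n - (m + lag)) => Y (m + lag + 1 + (i : ℕ)) ω) ⁻¹' As.1)).toReal
          * ((ℙ : Measure Ω)
            ((fun ω => fun i : Fin m => Y ((i : ℕ) + 1) ω) ⁻¹' Bs.1)).toReal|

/-- Increments of a measurable function that are pointwise `O(G)` are `O(G)` along every bounded
sequence of increments. -/
lemma increment_bounded_of_pointwise {h G : ℝ → ℝ} (hh : Measurable h) (hG : ∀ x, 0 < G x)
    (hpt : ∀ v, ∃ C, ∀ᶠ x in atTop, |h (x + v) - h x| ≤ C * G x)
    {x u : ℕ → ℝ} (hx : Tendsto x atTop atTop) (hu : ∀ n, |u n| ≤ 1)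
    (hcomp : ∃ C, ∀ᶠ n in atTop, G (x n + u n) ≤ C * G (x n)) :
    ∃ C, ∀ᶠ n in atTop, |h (x n + u n) - h (x n)| ≤ C * G (x n) := by
  have key : ∀ y : ℕ → ℝ, Tendsto y atTop atTop → ∃ V : ℕ → Set ℝ,
      (∀ N, V N = {v ∈ Icc (0 : ℝ) 3 | ∀ m ≥ N, |h (y m + v) - h (y m)| ≤ N * G (y m)}) ∧
      (∀ N, MeasurableSet (V N)) ∧ ∀ᶠ N in atTop, ENNReal.ofReal (5 / 2) < volume (V N) := by
    intro y hy
    refine ⟨_, fun N => rfl, fun N => ?_, ?_⟩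
    · have : {v ∈ Icc (0 : ℝ) 3 | ∀ m ≥ N, |h (y m + v) - h (y m)| ≤ N * G (y m)}
          = Icc 0 3 ∩ ⋂ m, ⋂ (_ : m ≥ N), {v | |h (y m + v) - h (y m)| ≤ N * G (y m)} := by
        ext v; simp
      rw [this]
      refine measurableSet_Icc.inter (MeasurableSet.iInter fun m => MeasurableSet.iInter fun _ => ?_)
      exact measurableSet_le (by fun_prop) measurable_const
    · set V : ℕ → Set ℝ := fun N =>
        {v ∈ Icc (0 : ℝ) 3 | ∀ m ≥ N, |h (y m + v) - h (y m)| ≤ N * G (y m)} with hV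
      have hmono : Monotone V := by
        intro N N' hN v hv
        refine ⟨hv.1, fun m hm => (hv.2 m (hN.trans hm)).trans ?_⟩
        exact mul_le_mul_of_nonneg_right (by exact_mod_cast hN) (hG _).le
      have hun : ⋃ N, V N = Icc (0 : ℝ) 3 := by
        refine Subset.antisymm (iUnion_subset fun N v hv => hv.1) fun v hv => ?_
        obtain ⟨C, hC⟩ := hpt v
        obtain ⟨N₁, hN₁⟩ := eventually_atTop.1 (hy.eventually hC)
        obtain ⟨N₂, hN₂⟩ := exists_nat_ge C
        refine mem_iUnion.2 ⟨max N₁ N₂, hv, fun m hm => (hN₁ m ((le_max_left _ _).trans hm)).trans ?_⟩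
        refine mul_le_mul_of_nonneg_right (hN₂.trans ?_) (hG _).le
        exact_mod_cast le_max_right _ _
      have := tendsto_measure_iUnion_atTop (μ := volume) hmono
      rw [hun, Real.volume_Icc] at this
      exact this.eventually (lt_mem_nhds (ENNReal.ofReal_lt_ofReal_iff (by norm_num) |>.2 (by norm_num)))
  have hy : Tendsto (fun n => x n + u n) atTop atTop := by
    refine tendsto_atTop_add_right_of_le _ (-1) hx fun n => (abs_le.1 (hu n)).1
  obtain ⟨V, hV, hVm, hVl⟩ := key x hx
  obtain ⟨W, hW, hWm, hWl⟩ := key _ hy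
  obtain ⟨N, hN₁, hN₂⟩ := (hVl.and hWl).exists
  obtain ⟨C, hC⟩ := hcomp
  refine ⟨N * (1 + C), ?_⟩
  filter_upwards [hC, eventually_ge_atTop N] with m hm hmN
  have hint : (V N ∩ (fun z => z + -u m) ⁻¹' W N).Nonempty := by
    by_contra hne
    rw [not_nonempty_iff_eq_empty, ← disjoint_iff_inter_eq_empty] at hne
    have h1 := measure_union (μ := volume) hne ((measurable_add_const (-u m)) (hWm N))
    rw [measure_preimage_add_right] at h1
    have h2 : volume (V N ∪ (fun z => z + -u m) ⁻¹' W N) ≤ volume (Icc (-1 : ℝ) 4) := by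
      refine measure_mono (union_subset ?_ ?_)
      · rw [hV]; exact fun v hv => ⟨by linarith [hv.1.1], by linarith [hv.1.2]⟩
      · rw [hW]; intro v hv
        have h3 := hv.1
        simp only [mem_Icc] at h3
        have h4 := abs_le.1 (hu m)
        exact ⟨by linarith, by linarith⟩
    rw [h1, Real.volume_Icc] at h2
    have h3 := ENNReal.add_lt_add hN₁ hN₂
    rw [← ENNReal.ofReal_add (by norm_num) (by norm_num)] at h3
    norm_num at h2 h3
    exact absurd h2 (not_le.2 h3)
  obtain ⟨v, hv, hw⟩ := hint
  rw [hV] at hv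
  rw [mem_preimage, hW] at hw
  have h1 := hv.2 m hmN
  have h2 := hw.2 m hmN
  have h3 : x m + u m + (v + -u m) = x m + v := by ring
  rw [h3] at h2
  have h4 : |h (x m + u m) - h (x m)| ≤ |h (x m + v) - h (x m)| + |h (x m + v) - h (x m + u m)| := by
    rw [show h (x m + u m) - h (x m)
      = (h (x m + v) - h (x m)) - (h (x m + v) - h (x m + u m)) by ring]
    exact abs_sub _ _
  have h5 : (N : ℝ) * G (x m + u m) ≤ N * (C * G (x m)) :=
    mul_le_mul_of_nonneg_left hm (Nat.cast_nonneg _)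
  nlinarith

lemma tailDF_nonneg (μ : Measure ℝ) (x : ℝ) : 0 ≤ tailDF μ x := ENNReal.toReal_nonneg

lemma tailDF_antitone (μ : Measure ℝ) [IsProbabilityMeasure μ] : Antitone (tailDF μ) :=
  fun _ _ h => ENNReal.toReal_mono (measure_ne_top _ _) (measure_mono (Ioi_subset_Ioi h))

lemma df_eq_cdf (μ : Measure ℝ) [IsProbabilityMeasure μ] (x : ℝ) : df μ x = cdf μ x := by
  rw [cdf_eq_real]; rfl

lemma tailDF_eq_one_sub (μ : Measure ℝ) [IsProbabilityMeasure μ] (x : ℝ) :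
    tailDF μ x = 1 - df μ x := by
  have h := prob_compl_eq_one_sub (μ := μ) (measurableSet_Iic (a := x))
  rw [compl_Iic] at h
  rw [tailDF, df, h, ENNReal.toReal_sub_of_le prob_le_one ENNReal.one_ne_top, ENNReal.toReal_one]

lemma tailDF_quantileB_le (μ : Measure ℝ) [IsProbabilityMeasure μ] {q : ℝ} (hq : 0 < q) :
    tailDF μ (quantileB μ q) ≤ q⁻¹ := by
  have hne : {y : ℝ | 1 - q⁻¹ ≤ df μ y}.Nonempty := by
    have := (tendsto_cdf_atTop μ).eventually
      (lt_mem_nhds (show 1 - q⁻¹ < 1 by linarith [inv_pos.2 hq]))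
    obtain ⟨y, hy⟩ := this.exists
    exact ⟨y, by rw [mem_ofPred, df_eq_cdf]; exact hy.le⟩
  by_contra! hlt
  have hrc := (cdf μ).right_continuous (quantileB μ q)
  have h1 : cdf μ (quantileB μ q) < 1 - q⁻¹ := by
    rw [← df_eq_cdf]; rw [tailDF_eq_one_sub] at hlt; linarith
  have h2 := hrc.eventually (gt_mem_nhds h1)
  have h3 : ∀ᶠ y in nhdsWithin (quantileB μ q) (Ioi (quantileB μ q)), cdf μ y < 1 - q⁻¹ :=
    h2.filter_mono (nhdsWithin_mono _ Ioi_subset_Ici_self)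
  obtain ⟨y, hy, hyq⟩ := (h3.and self_mem_nhdsWithin).exists
  obtain ⟨z, hz, hzy⟩ := exists_lt_of_csInf_lt hne hyq
  rw [mem_ofPred, df_eq_cdf] at hz
  linarith [(cdf μ).mono hzy.le]

lemma le_tailDF_of_lt_quantileB (μ : Measure ℝ) [IsProbabilityMeasure μ] (hμ : μ (Iio 0) = 0)
    {q y : ℝ} (hq : 1 < q) (hy : y < quantileB μ q) : q⁻¹ ≤ tailDF μ y := by
  have hbdd : BddBelow {y : ℝ | 1 - q⁻¹ ≤ df μ y} := by
    refine ⟨0, fun z hz => ?_⟩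
    by_contra! hlt
    have : μ (Iic z) = 0 := measure_mono_null (Iic_subset_Iio.2 hlt) hμ
    rw [mem_ofPred, df, this, ENNReal.toReal_zero] at hz
    linarith [inv_lt_one_of_one_lt₀ hq]
  by_contra! hlt
  refine absurd (csInf_le hbdd (?_ : y ∈ _)) (not_le.2 hy)
  rw [mem_ofPred]; rw [tailDF_eq_one_sub] at hlt; linarith

section Pareto
variable {μ : Measure ℝ} [IsProbabilityMeasure μ] {α : ℝ} {l : ℝ → ℝ}

lemma ParetoTail.tailDF_pos (hP : ParetoTail μ α l) (x : ℝ) : 0 < tailDF μ x := by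
  have h := (hP.1.2 1 one_pos).eventually_ne one_ne_zero
  obtain ⟨y, hy, hy0, hyx⟩ := (h.and ((eventually_gt_atTop 0).and (eventually_ge_atTop x))).exists
  have hly : l y ≠ 0 := by rintro h0; simp [h0] at hy
  have : tailDF μ y ≠ 0 := by
    rw [hP.2 y hy0]; exact mul_ne_zero (Real.rpow_pos_of_pos hy0 _).ne' hly
  exact (lt_of_le_of_ne (tailDF_nonneg _ _) this.symm).trans_le (tailDF_antitone μ hyx)

lemma ParetoTail.slow_pos (hP : ParetoTail μ α l) {x : ℝ} (hx : 0 < x) : 0 < l x := by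
  have h := hP.tailDF_pos x
  rw [hP.2 x hx] at h
  exact (mul_pos_iff_of_pos_left (Real.rpow_pos_of_pos hx _)).1 h

lemma ParetoTail.tendsto_ratio (hP : ParetoTail μ α l) {a : ℝ} (ha : 0 < a) :
    Tendsto (fun x => tailDF μ (a * x) / tailDF μ x) atTop (nhds (a ^ (-α))) := by
  have h := (hP.1.2 a ha).const_mul (a ^ (-α))
  rw [mul_one] at h
  refine h.congr' ?_
  filter_upwards [eventually_gt_atTop 0] with x hx
  have hl := (hP.slow_pos hx).ne'
  have hx' := (Real.rpow_pos_of_pos hx (-α)).ne'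
  rw [hP.2 x hx, hP.2 _ (mul_pos ha hx), Real.mul_rpow ha.le hx.le]
  field_simp

lemma ParetoTail.exists_geometric (hP : ParetoTail μ α l) (hα : 0 < α) {a : ℝ} (ha : 1 < a) :
    ∃ θ : ℝ, 0 ≤ θ ∧ θ < 1 ∧ ∃ x₀ : ℝ, ∀ x ≥ x₀, tailDF μ (a * x) ≤ θ * tailDF μ x := by
  have h1 : a ^ (-α) < 1 := Real.rpow_lt_one_of_one_lt_of_neg ha (by linarith)
  obtain ⟨θ, hθ1, hθ2⟩ := exists_between h1
  have h0 : 0 < a ^ (-α) := Real.rpow_pos_of_pos (by linarith) _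
  obtain ⟨x₀, hx₀⟩ := eventually_atTop.1
    ((hP.tendsto_ratio (by linarith : 0 < a)).eventually (gt_mem_nhds hθ1))
  exact ⟨θ, by linarith, hθ2, x₀, fun x hx => ((div_lt_iff₀ (hP.tailDF_pos x)).1 (hx₀ x hx)).le⟩

lemma ParetoTail.tendsto_quantileB (hP : ParetoTail μ α l) :
    Tendsto (quantileB μ) atTop atTop := by
  refine tendsto_atTop.2 fun M => ?_
  filter_upwards [eventually_gt_atTop (tailDF μ M)⁻¹] with q hq
  have hT := hP.tailDF_pos M
  have hq0 : 0 < q := (inv_pos.2 hT).trans hq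
  by_contra! hlt
  have h1 := (tailDF_antitone μ hlt.le).trans (tailDF_quantileB_le μ hq0)
  exact absurd (inv_lt_of_inv_lt₀ hT hq) (not_lt.2 h1)

lemma abs_log_le_two_mul_abs_sub_one {r : ℝ} (hr : |r - 1| ≤ 1 / 2) :
    |Real.log r| ≤ 2 * |r - 1| := by
  have hr' := abs_le.1 hr
  have h0 : 0 < r := by linarith
  have h1 := Real.log_le_sub_one_of_pos h0
  have h2 := Real.one_sub_inv_le_log_of_pos h0
  have h3 : -(2 * |r - 1|) ≤ 1 - r⁻¹ := by
    have : 1 - r⁻¹ = (r - 1) / r := by field_simp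
    rw [this, le_div_iff₀ h0]
    rcases abs_cases (r - 1) with h | h <;> rw [h.1] <;> nlinarith
  rw [abs_le]
  exact ⟨by linarith, by linarith [le_abs_self (r - 1), abs_nonneg (r - 1)]⟩

lemma SecondOrderRV.log_slow_increment {g : ℝ → ℝ} {K γ : ℝ} (hP : ParetoTail μ α l)
    (hS : SecondOrderRV l g K γ) {b u : ℕ → ℝ} (hb : Tendsto b atTop atTop)
    (hu : ∀ n, |u n| ≤ 1) :
    ∃ C, ∀ᶠ n in atTop, |Real.log (l (b n * Real.exp (u n))) - Real.log (l (b n))| ≤ C * g (b n) := by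
  obtain ⟨-, hg0, ⟨hgm, hgr⟩, hκ⟩ := hS
  have hx : Tendsto (fun n => Real.log (b n)) atTop atTop := Real.tendsto_log_atTop.comp hb
  have hexp : ∀ᶠ n in atTop, Real.exp (Real.log (b n)) = b n ∧
      Real.exp (Real.log (b n) + u n) = b n * Real.exp (u n) := by
    filter_upwards [hb.eventually (eventually_gt_atTop 0)] with n hn
    rw [Real.exp_add, Real.exp_log hn]; exact ⟨rfl, rfl⟩
  have h1 := increment_bounded_of_pointwise (h := fun s => Real.log (g (Real.exp s)))
    (G := fun _ => 1) (by fun_prop) (fun _ => one_pos) (fun v => ?_) hx hu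
    ⟨1, by simp⟩
  · obtain ⟨C, hC⟩ := h1
    have h2 := increment_bounded_of_pointwise (h := fun s => Real.log (l (Real.exp s)))
      (G := fun s => g (Real.exp s)) ?_ (fun _ => hg0 _) (fun v => ?_) hx hu ?_
    · obtain ⟨C', hC'⟩ := h2
      refine ⟨C', ?_⟩
      filter_upwards [hC', hexp] with n hn he
      rwa [he.1, he.2] at hn
    · exact (hP.1.1.comp Real.measurable_exp).log
    · have e1 : Tendsto (fun s => l (Real.exp v * Real.exp s) / l (Real.exp s)) atTop (nhds 1) :=
        (hP.1.2 _ (Real.exp_pos v)).comp Real.tendsto_exp_atTop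
      have e2 : Tendsto (fun s => (l (Real.exp v * Real.exp s) / l (Real.exp s) - 1) / g (Real.exp s))
        atTop (nhds _) := (hκ _ (Real.exp_pos v)).comp Real.tendsto_exp_atTop
      refine ⟨2 * (|kappaFun K γ (Real.exp v)| + 1), ?_⟩
      filter_upwards [e1.eventually (Metric.closedBall_mem_nhds 1 (by norm_num : (0:ℝ) < 1 / 2)),
        e2.abs.eventually (gt_mem_nhds (lt_add_one _))] with s hs1 hs2
      rw [Real.dist_eq] at hs1
      have e3 := abs_log_le_two_mul_abs_sub_one hs1
      rw [Real.log_div (hP.slow_pos (by positivity)).ne' (hP.slow_pos (by positivity)).ne',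
        ← Real.exp_add, add_comm v s] at e3
      rw [abs_div, abs_of_pos (hg0 _), div_lt_iff₀ (hg0 _)] at hs2
      rw [← Real.exp_add, add_comm v s] at hs2
      linarith
    · refine ⟨Real.exp C, ?_⟩
      filter_upwards [hC] with n hn
      rw [mul_one] at hn
      have := (abs_le.1 hn).2
      rw [← Real.log_div (hg0 _).ne' (hg0 _).ne', Real.log_le_iff_le_exp (div_pos (hg0 _) (hg0 _)),
        div_le_iff₀ (hg0 _)] at this
      exact this
  · have e1 : Tendsto (fun s => g (Real.exp v * Real.exp s) / g (Real.exp s)) atTop (nhds _) :=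
      (hgr _ (Real.exp_pos v)).comp Real.tendsto_exp_atTop
    have e2 := (e1.log (Real.rpow_pos_of_pos (Real.exp_pos v) γ).ne').abs
    refine ⟨|Real.log (Real.exp v ^ γ)| + 1,
      (e2.eventually (gt_mem_nhds (lt_add_one _))).mono fun s hs => ?_⟩
    · rw [Real.log_div (hg0 _).ne' (hg0 _).ne', ← Real.exp_add, add_comm v s] at hs
      rw [mul_one]
      exact hs.le

lemma SecondOrderRV.log_tail_increment {g : ℝ → ℝ} {K γ : ℝ} (hP : ParetoTail μ α l)
    (hS : SecondOrderRV l g K γ) {b u : ℕ → ℝ} (hb : Tendsto b atTop atTop)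
    (hu : ∀ n, |u n| ≤ 1) :
    ∃ C, ∀ᶠ n in atTop, |Real.log (tailDF μ (b n * Real.exp (u n))) - Real.log (tailDF μ (b n))
      + α * u n| ≤ C * g (b n) := by
  obtain ⟨C, hC⟩ := hS.log_slow_increment hP hb hu
  refine ⟨C, ?_⟩
  filter_upwards [hC, hb.eventually (eventually_gt_atTop 0)] with n hn h0
  have h1 : 0 < b n * Real.exp (u n) := mul_pos h0 (Real.exp_pos _)
  rw [hP.2 _ h0, hP.2 _ h1, Real.log_mul (Real.rpow_pos_of_pos h1 _).ne' (hP.slow_pos h1).ne',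
    Real.log_mul (Real.rpow_pos_of_pos h0 _).ne' (hP.slow_pos h0).ne', Real.log_rpow h1,
    Real.log_rpow h0, Real.log_mul h0.ne' (Real.exp_pos _).ne', Real.log_exp]
  refine (congrArg abs ?_).trans_le hn
  ring

lemma TailFraction.eventually_pos {k : ℕ → ℕ} (hk : TailFraction k) : ∀ᶠ n in atTop, 0 < k n :=
  (hk.1.eventually (eventually_gt_atTop 0)).mono fun n hn => by exact_mod_cast hn

lemma TailFraction.tendsto_sqrt {k : ℕ → ℕ} (hk : TailFraction k) :
    Tendsto (fun n => Real.sqrt (k n)) atTop atTop :=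
  Real.tendsto_sqrt_atTop.comp hk.1

lemma TailFraction.tendsto_sqrt_div {k : ℕ → ℕ} (hk : TailFraction k) :
    Tendsto (fun n : ℕ => Real.sqrt (k n) / n) atTop (nhds 0) := by
  refine squeeze_zero' (.of_forall fun n => by positivity) ?_ hk.2
  filter_upwards [hk.eventually_pos] with n hn
  gcongr
  rw [Real.sqrt_le_left (by positivity)]
  have : (1 : ℝ) ≤ k n := by exact_mod_cast hn
  nlinarith

lemma TailFraction.tendsto_div {k : ℕ → ℕ} (hk : TailFraction k) :
    Tendsto (fun n : ℕ => (n : ℝ) / k n) atTop atTop := by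
  have h : Tendsto (fun n : ℕ => (k n : ℝ) / n) atTop (nhdsWithin 0 (Ioi 0)) := by
    refine tendsto_nhdsWithin_iff.2 ⟨hk.2, ?_⟩
    filter_upwards [hk.eventually_pos, eventually_gt_atTop 0] with n h1 h2
    have hk' : (0 : ℝ) < k n := by exact_mod_cast h1
    have hn' : (0 : ℝ) < n := by exact_mod_cast h2
    exact div_pos hk' hn'
  exact h.inv_tendsto_nhdsGT_zero.congr fun n => by simp

lemma TailFraction.tendsto_div_sqrt {k : ℕ → ℕ} (hk : TailFraction k) :
    Tendsto (fun n : ℕ => (n : ℝ) / Real.sqrt (k n)) atTop atTop := by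
  have h : Tendsto (fun n : ℕ => Real.sqrt (k n) / n) atTop (nhdsWithin 0 (Ioi 0)) := by
    refine tendsto_nhdsWithin_iff.2 ⟨hk.tendsto_sqrt_div, ?_⟩
    filter_upwards [hk.eventually_pos, eventually_gt_atTop 0] with n h1 h2
    have hk' : (0 : ℝ) < k n := by exact_mod_cast h1
    have hn' : (0 : ℝ) < n := by exact_mod_cast h2
    exact div_pos (Real.sqrt_pos.2 hk') hn'
  exact h.inv_tendsto_nhdsGT_zero.congr fun n => by simp

/-- The tail at the perturbed quantile, to second order. -/
lemma SecondOrderRV.tendsto_tail_quantileB {g : ℝ → ℝ} {K γ : ℝ} (hα : 0 < α)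
    (hP : ParetoTail μ α l)
    (hS : SecondOrderRV l g K γ) (hμ : μ (Iio 0) = 0) {k : ℕ → ℕ} (hk : TailFraction k)
    (hB3 : Tendsto (fun n : ℕ => Real.sqrt (k n) * g (quantileB μ ((n : ℝ) / k n))) atTop (nhds 0))
    (t : ℝ) :
    Tendsto (fun n : ℕ => Real.sqrt (k n) * ((n : ℝ) / k n *
      tailDF μ (quantileB μ ((n : ℝ) / k n) * Real.exp (t / Real.sqrt (k n))) - 1))
      atTop (nhds (-(α * t))) := by
  set b : ℕ → ℝ := fun n => quantileB μ ((n : ℝ) / k n)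
  set s : ℕ → ℝ := fun n => Real.sqrt (k n)
  have hs : Tendsto s atTop atTop := hk.tendsto_sqrt
  have hb : Tendsto b atTop atTop := hP.tendsto_quantileB.comp hk.tendsto_div
  have hs0 : ∀ᶠ n in atTop, 0 < s n := hs.eventually (eventually_gt_atTop 0)
  have hts : Tendsto (fun n => t / s n) atTop (nhds 0) := hs.const_div_atTop t
  obtain ⟨C₁, hC₁⟩ := hS.log_tail_increment hP hb (u := fun n => max (-1) (min 1 (t / s n)))
    (fun n => abs_le.2 ⟨le_max_left _ _, max_le (by norm_num) (min_le_left _ _)⟩)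
  obtain ⟨C₂, hC₂⟩ := hS.log_tail_increment hP hb (u := fun n => -(1 / ((n : ℝ) + 1)))
    (fun n => by
      rw [abs_neg, abs_of_pos (by positivity), div_le_one (by positivity)]
      linarith [(Nat.cast_nonneg n : (0 : ℝ) ≤ n)])
  set L : ℕ → ℝ := fun n => Real.log ((n : ℝ) / k n * tailDF μ (b n * Real.exp (t / s n)))
  have hbound : ∀ᶠ n in atTop, |s n * L n + α * t|
      ≤ (C₁ + C₂) * (s n * g (b n)) + α * (s n / n) := by
    filter_upwards [hC₁, hC₂, hs0, hb.eventually (eventually_gt_atTop 0), eventually_gt_atTop 0,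
      hk.tendsto_div.eventually (eventually_gt_atTop 1),
      hts.eventually (Icc_mem_nhds (by norm_num : (-1 : ℝ) < 0) one_pos)]
      with n h1 h2 h3 h4 h5 h6 h7
    rw [min_eq_right h7.2, max_eq_right h7.1] at h1
    have hT := hP.tailDF_pos (b n)
    have hq0 : 0 < (n : ℝ) / k n := by linarith
    have h8 : Real.log (tailDF μ (b n)) ≤ -Real.log ((n : ℝ) / k n) := by
      rw [← Real.log_inv]; exact Real.log_le_log hT (tailDF_quantileB_le μ hq0)
    have h9 : -Real.log ((n : ℝ) / k n)
        ≤ Real.log (tailDF μ (b n * Real.exp (-(1 / ((n : ℝ) + 1))))) := by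
      rw [← Real.log_inv]
      refine Real.log_le_log (by positivity) (le_tailDF_of_lt_quantileB μ hμ h6 ?_)
      refine mul_lt_of_lt_one_right h4 (Real.exp_lt_one_iff.2 ?_)
      rw [neg_lt_zero]; positivity
    have h10 : L n = Real.log ((n : ℝ) / k n)
        + Real.log (tailDF μ (b n * Real.exp (t / s n))) :=
      Real.log_mul hq0.ne' (hP.tailDF_pos _).ne'
    have hn0 : (0 : ℝ) < n := by exact_mod_cast h5
    have h11 : 1 / ((n : ℝ) + 1) ≤ 1 / n := by gcongr; linarith
    have h12 := mul_le_mul_of_nonneg_left h11 hα.le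
    have h13 := abs_le.1 h1
    have h14 := abs_le.1 h2
    have h15 : |L n + α * (t / s n)| ≤ (C₁ + C₂) * g (b n) + α * (1 / n) := by
      rw [abs_le, h10]
      have := abs_nonneg (Real.log (tailDF μ (b n * Real.exp (-(1 / ((n : ℝ) + 1)))))
        - Real.log (tailDF μ (b n)) + α * -(1 / ((n : ℝ) + 1)))
      have : 0 ≤ α * (1 / (n : ℝ)) := by positivity
      constructor <;> linarith
    have h16 : s n * L n + α * t = s n * (L n + α * (t / s n)) := by field_simp
    rw [h16, abs_mul, abs_of_pos h3]
    refine (mul_le_mul_of_nonneg_left h15 h3.le).trans_eq ?_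
    ring
  have hsL : Tendsto (fun n => s n * L n) atTop (nhds (-(α * t))) := by
    have h1 : Tendsto (fun n : ℕ => (C₁ + C₂) * (s n * g (b n)) + α * (s n / n)) atTop (nhds 0) := by
      simpa using (hB3.const_mul (C₁ + C₂)).add (hk.tendsto_sqrt_div.const_mul α)
    have h2 := squeeze_zero_norm' (f := fun n => s n * L n + α * t) (a := fun n : ℕ => (C₁ + C₂) * (s n * g (b n)) + α * (s n / n))
      (by simpa only [Real.norm_eq_abs] using hbound) h1
    have h3 := h2.add_const (-(α * t))
    simpa using h3
  have hL : Tendsto L atTop (nhds 0) := by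
    refine (hsL.mul hs.inv_tendsto_atTop |>.congr' ?_).trans (by simp)
    filter_upwards [hs0] with n hn
    simp only [Pi.inv_apply]
    field_simp
  have hsq : Tendsto (fun n => |s n * L n| * |L n|) atTop (nhds 0) := by
    simpa using hsL.abs.mul hL.abs
  have hexp : Tendsto (fun n => s n * (Real.exp (L n) - 1 - L n)) atTop (nhds 0) := by
    refine squeeze_zero_norm' ?_ hsq
    filter_upwards [hL.eventually (Metric.closedBall_mem_nhds 0 one_pos)] with n hn
    rw [dist_zero_right, Real.norm_eq_abs] at hn
    rw [Real.norm_eq_abs, abs_mul, abs_mul, mul_assoc, ← sq, sq_abs]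
    exact mul_le_mul_of_nonneg_left (Real.abs_exp_sub_one_sub_id_le hn) (abs_nonneg _)
  refine ((hexp.add hsL).congr' ?_).trans (by simp)
  filter_upwards [hk.tendsto_div.eventually (eventually_gt_atTop 0)] with n hn
  simp only [L]
  rw [Real.exp_log (mul_pos hn (hP.tailDF_pos _))]
  ring
end Pareto

lemma measureReal_lt_eq_tailDF {Ω : Type*} [MeasureSpace Ω] {Y : Ω → ℝ} (hY : Measurable Y)
    (x : ℝ) : (ℙ : Measure Ω).real {ω | x < Y ω} = tailDF (Measure.map Y ℙ) x := by
  rw [tailDF, Measure.map_apply hY measurableSet_Ioi]; rfl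

lemma tendsto_measureReal_lt_atTop {Ω : Type*} [MeasureSpace Ω]
    [IsProbabilityMeasure (ℙ : Measure Ω)] {Y : Ω → ℝ} (hY : Measurable Y) :
    Tendsto (fun x => (ℙ : Measure Ω).real {ω | x < Y ω}) atTop (nhds 0) := by
  have : IsProbabilityMeasure (Measure.map Y (ℙ : Measure Ω)) :=
    Measure.isProbabilityMeasure_map hY.aemeasurable
  have h := (tendsto_cdf_atTop (Measure.map Y (ℙ : Measure Ω))).const_sub 1
  rw [sub_self] at h
  refine h.congr fun x => ?_
  rw [measureReal_lt_eq_tailDF hY, tailDF_eq_one_sub, df_eq_cdf]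

/-- The modulus of `W` has a tail of at most the order of the tail of `μ`. -/
def TailDominated {Ω : Type*} [MeasureSpace Ω] (μ : Measure ℝ) (W : Ω → ℂ) : Prop :=
  ∃ C c x₀ : ℝ, 0 ≤ C ∧ 0 < c ∧
    ∀ x ≥ x₀, (ℙ : Measure Ω).real {ω | x < ‖W ω‖} ≤ C * tailDF μ (c * x)

section Domination

variable {Ω : Type*} [MeasureSpace Ω] {μ : Measure ℝ}

lemma TailDominated.of_smul {W : Ω → ℂ} {a : ℂ} (ha : a ≠ 0) (h : TailDominated μ (a • W)) :
    TailDominated μ W := by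
  obtain ⟨C, c, x₀, hC, hc, h⟩ := h
  have ha' : 0 < ‖a‖ := norm_pos_iff.2 ha
  refine ⟨C, c * ‖a‖, x₀ / ‖a‖, hC, by positivity, fun x hx => ?_⟩
  rw [ge_iff_le, div_le_iff₀' ha'] at hx
  have := h _ hx
  simp only [Pi.smul_apply, smul_eq_mul, norm_mul, mul_lt_mul_iff_right₀ ha'] at this
  rwa [mul_assoc]

lemma TailDominated.of_expansion [IsProbabilityMeasure (ℙ : Measure Ω)] [IsProbabilityMeasure μ]
    {α : ℝ} {l : ℝ → ℝ} (hP : ParetoTail μ α l) (hα : 0 < α) {W W' V : Ω → ℂ}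
    (hW : Measurable W)
    (heq : ∀ x, (ℙ : Measure Ω).real {ω | x < ‖W' ω‖} = (ℙ : Measure Ω).real {ω | x < ‖W ω‖})
    {ρ : ℝ} (hρ : 1 < ρ) (hle : ∀ ω, ρ * ‖W ω‖ ≤ ‖W' ω‖ + ‖V ω‖) (hV : TailDominated μ V) :
    TailDominated μ W := by
  obtain ⟨C, c, x₀, hC, hc, hV⟩ := hV
  set q : ℝ → ℝ := fun x => (ℙ : Measure Ω).real {ω | x < ‖W ω‖}
  obtain ⟨a, ha1, haρ⟩ := exists_between hρ
  set b := ρ - a with hb_def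
  have hb : 0 < b := by linarith
  have hstep : ∀ x, q x ≤ q (a * x) + (ℙ : Measure Ω).real {ω | b * x < ‖V ω‖} := by
    intro x
    have hsub : {ω | x < ‖W ω‖} ⊆ {ω | a * x < ‖W' ω‖} ∪ {ω | b * x < ‖V ω‖} := by
      intro ω (hω : x < ‖W ω‖)
      by_contra hcon
      simp only [mem_union, mem_ofPred, not_or, not_lt] at hcon
      have h1 := hle ω
      have h2 : ρ * x < ρ * ‖W ω‖ := by gcongr
      have h3 : ρ * x = a * x + b * x := by rw [hb_def]; ring
      linarith
    calc q x ≤ _ := measureReal_mono hsub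
      _ ≤ _ := measureReal_union_le _ _
      _ = _ := by rw [heq]
  obtain ⟨θ, hθ0, hθ1, x₁, hθ⟩ := hP.exists_geometric hα ha1
  set K := C / (1 - θ)
  have hK : C + K * θ = K := by
    have : 1 - θ ≠ 0 := by linarith
    simp only [K]; field_simp; ring
  have hK0 : 0 ≤ K := div_nonneg hC (by linarith)
  set x₂ := max 0 (max (x₀ / b) (x₁ / (c * b)))
  have key : ∀ N : ℕ, ∀ x ≥ x₂, q x ≤ K * tailDF μ (c * b * x) + q (a ^ N * x) := by
    intro N
    induction N with
    | zero =>
      intro x _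
      simp only [pow_zero, one_mul]
      linarith [mul_nonneg hK0 (tailDF_nonneg μ (c * b * x))]
    | succ N ih =>
      intro x hx
      have hx0 : 0 ≤ x := (le_max_left _ _).trans hx
      have hx1 : x₀ / b ≤ x := ((le_max_left _ _).trans (le_max_right _ _)).trans hx
      have hx2 : x₁ / (c * b) ≤ x := ((le_max_right _ _).trans (le_max_right _ _)).trans hx
      rw [div_le_iff₀' hb] at hx1
      rw [div_le_iff₀' (by positivity)] at hx2
      have h1 := hstep x
      have h2 := hV _ hx1
      have h3 := ih (a * x) (by nlinarith)
      have h4 := hθ _ hx2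
      have h5 : c * b * (a * x) = a * (c * b * x) := by ring
      have h6 : a ^ N * (a * x) = a ^ (N + 1) * x := by ring
      rw [h5, h6] at h3
      rw [← mul_assoc] at h2
      have h7 := mul_le_mul_of_nonneg_left h4 hK0
      have h8 : C * tailDF μ (c * b * x) + K * (θ * tailDF μ (c * b * x))
        = K * tailDF μ (c * b * x) := by
        rw [← mul_assoc, ← add_mul, hK]
      linarith
  refine ⟨K, c * b, max x₂ 1, hK0, by positivity, fun x hx => ?_⟩
  have hx0 : 0 < x := one_pos.trans_le ((le_max_right _ _).trans hx)
  have hlim : Tendsto (fun N : ℕ => K * tailDF μ (c * b * x) + q (a ^ N * x)) atTop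
      (nhds (K * tailDF μ (c * b * x) + 0)) := by
    refine Tendsto.const_add _ ((tendsto_measureReal_lt_atTop hW.norm).comp ?_)
    exact (tendsto_pow_atTop_atTop_of_one_lt ha1).atTop_mul_const hx0
  rw [add_zero] at hlim
  exact ge_of_tendsto' hlim fun N => key N x ((le_max_left _ _).trans hx)

end Domination

section Filters

variable {Ω : Type*}

/-- the lag operator on two-sided sequences of functions -/
def lagOp (Ω : Type*) : Module.End ℂ (ℤ → Ω → ℂ) where
  toFun f i := f (i - 1)
  map_add' _ _ := rfl
  map_smul' _ _ := rfl

/-- the linear filter `P(B) f`, where `B` is the lag operator -/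
def linFilter (P : Polynomial ℂ) (f : ℤ → Ω → ℂ) : ℤ → Ω → ℂ :=
  Polynomial.aeval (lagOp Ω) P f

lemma lagOp_apply (f : ℤ → Ω → ℂ) (i : ℤ) : lagOp Ω f i = f (i - 1) := rfl

lemma lagOp_pow_apply (j : ℕ) (f : ℤ → Ω → ℂ) (i : ℤ) : (lagOp Ω ^ j) f i = f (i - j) := by
  induction j generalizing i with
  | zero => simp
  | succ j ih =>
    rw [pow_succ', Module.End.mul_apply, lagOp_apply, ih]
    congr 1; push_cast; ring

lemma linFilter_mul (P Q : Polynomial ℂ) (f : ℤ → Ω → ℂ) :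
    linFilter (P * Q) f = linFilter P (linFilter Q f) := by
  simp [linFilter]

lemma linFilter_one (f : ℤ → Ω → ℂ) : linFilter 1 f = f := by simp [linFilter]

lemma linFilter_C (a : ℂ) (f : ℤ → Ω → ℂ) (i : ℤ) : linFilter (.C a) f i = a • f i := by
  simp [linFilter]

lemma linFilter_X_sub_C (r : ℂ) (f : ℤ → Ω → ℂ) (i : ℤ) (ω : Ω) :
    linFilter (.X - .C r) f i ω = f (i - 1) ω - r * f i ω := by
  simp [linFilter, lagOp_apply]

lemma linFilter_eq_sum (P : Polynomial ℂ) (f : ℤ → Ω → ℂ) (i : ℤ) (ω : Ω) :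
    linFilter P f i ω = ∑ j ∈ Finset.range (P.natDegree + 1), P.coeff j * f (i - j) ω := by
  simp [linFilter, Polynomial.aeval_eq_sum_range, Finset.sum_apply, lagOp_pow_apply]

variable [MeasureSpace Ω]

lemma measurable_linFilter (P : Polynomial ℂ) {f : ℤ → Ω → ℂ} (hf : ∀ i, Measurable (f i)) (i : ℤ) :
    Measurable (linFilter P f i) := by
  have : linFilter P f i = fun ω => ∑ j ∈ Finset.range (P.natDegree + 1), P.coeff j * f (i - j) ω :=
    funext fun ω => linFilter_eq_sum P f i ω
  rw [this]
  exact Finset.measurable_sum _ fun j _ => (hf _).const_mul _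

/-- Filtering a stationary sequence produces identically distributed moduli. -/
lemma IsStationaryZ.measureReal_linFilter {X : ℤ → Ω → ℝ} (hX : IsStationaryZ X)
    (hXm : ∀ i, Measurable (X i)) (P : Polynomial ℂ) (x : ℝ) (i : ℤ) :
    (ℙ : Measure Ω).real {ω | x < ‖linFilter P (fun j ω => (X j ω : ℂ)) i ω‖}
      = (ℙ : Measure Ω).real {ω | x < ‖linFilter P (fun j ω => (X j ω : ℂ)) 0 ω‖} := by
  set S : Set (ℤ → ℝ) :=
    {y | x < ‖∑ j ∈ Finset.range (P.natDegree + 1), P.coeff j * (y (-(j : ℤ)) : ℂ)‖}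
  have hS : MeasurableSet S := by
    refine measurableSet_lt measurable_const (Measurable.norm ?_)
    exact Finset.measurable_sum _ fun j _ =>
      (Complex.measurable_ofReal.comp (measurable_pi_apply _)).const_mul _
  have hm : ∀ i : ℤ, Measurable fun ω => fun j : ℤ => X (j + i) ω :=
    fun i => measurable_pi_lambda _ fun j => hXm _
  have h := congrArg (fun ν : Measure (ℤ → ℝ) => ν.real S) (hX i)
  simp only [measureReal_def] at h
  rw [Measure.map_apply (hm i) hS, Measure.map_apply (by simpa using hm 0) hS] at h
  simp only [measureReal_def]
  convert h using 4
  · ext ω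
    simp only [S, linFilter_eq_sum, mem_preimage, mem_ofPred, neg_add_eq_sub]
  · ext ω
    simp only [S, linFilter_eq_sum, mem_preimage, mem_ofPred, zero_sub]

/-- If a filter whose zeros all lie outside the closed unit disc produces an output dominated by
a Pareto tail, then its input is dominated as well. -/
lemma TailDominated.of_linFilter [IsProbabilityMeasure (ℙ : Measure Ω)] {μ : Measure ℝ}
    [IsProbabilityMeasure μ] {α : ℝ} {l : ℝ → ℝ} (hP : ParetoTail μ α l) (hα : 0 < α)
    {X : ℤ → Ω → ℝ} (hX : IsStationaryZ X) (hXm : ∀ i, Measurable (X i)) (R Q : Polynomial ℂ)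
    (hQ : Q ≠ 0) (hroot : ∀ r, Q.IsRoot r → 1 < ‖r‖)
    (h : TailDominated μ (linFilter (Q * R) (fun j ω => (X j ω : ℂ)) 0)) :
    TailDominated μ (linFilter R (fun j ω => (X j ω : ℂ)) 0) := by
  induction hn : Q.natDegree generalizing Q with
  | zero =>
    obtain ⟨a, rfl⟩ := Polynomial.natDegree_eq_zero.1 hn
    rw [linFilter_mul] at h
    have h' : TailDominated μ (a • linFilter R (fun j ω => (X j ω : ℂ)) 0) := by
      rwa [← linFilter_C]
    exact h'.of_smul (by simpa using hQ)
  | succ n ih =>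
    obtain ⟨r, hr⟩ := IsAlgClosed.exists_root Q (by
      rw [Polynomial.degree_eq_natDegree hQ, hn]; exact_mod_cast n.succ_ne_zero)
    obtain ⟨Q', rfl⟩ := Polynomial.dvd_iff_isRoot.2 hr
    have hQ' : Q' ≠ 0 := right_ne_zero_of_mul hQ
    have hdeg : Q'.natDegree = n := by
      rw [Polynomial.natDegree_mul (Polynomial.X_sub_C_ne_zero r) hQ',
        Polynomial.natDegree_X_sub_C] at hn
      omega
    refine ih Q' hQ' (fun s hs => hroot s ?_) ?_ hdeg
    · simp only [Polynomial.IsRoot.def, Polynomial.eval_mul] at hs ⊢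
      rw [hs, mul_zero]
    rw [mul_assoc, linFilter_mul] at h
    refine TailDominated.of_expansion hP hα
      (measurable_linFilter _ (fun i => Complex.measurable_ofReal.comp (hXm i)) _)
      (W' := linFilter (Q' * R) (fun j ω => (X j ω : ℂ)) (-1))
      (fun x => hX.measureReal_linFilter hXm _ x _) (hroot r hr) (fun ω => ?_) h
    rw [linFilter_X_sub_C, zero_sub, ← norm_mul]
    rw [norm_sub_rev]
    exact norm_le_norm_add_norm_sub' _ _

end Filters

/-- the event that the sequence `S` leaves the ball of radius `M` for the first time at `j` -/
def firstExit {Ω : Type*} (S : ℕ → Ω → ℂ) (M : ℝ) (j : ℕ) : Set Ω :=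
  {ω | (∀ i ∈ Finset.range j, ‖S i ω‖ ≤ M) ∧ M < ‖S j ω‖}

lemma measurableSet_firstExit {Ω : Type*} [MeasurableSpace Ω] {S : ℕ → Ω → ℂ} (M : ℝ) (j : ℕ)
    (hS : ∀ i ≤ j, Measurable (S i)) : MeasurableSet (firstExit S M j) := by
  have h1 : MeasurableSet (⋂ i ∈ Finset.range j, {ω | ‖S i ω‖ ≤ M}) :=
    Finset.measurableSet_biInter _ fun i hi =>
      measurableSet_le (hS i (Finset.mem_range.1 hi).le).norm measurable_const
  have h2 : firstExit S M j = (⋂ i ∈ Finset.range j, {ω | ‖S i ω‖ ≤ M}) ∩ {ω | M < ‖S j ω‖} := by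
    ext ω; simp [firstExit]
  rw [h2]
  exact h1.inter (measurableSet_lt measurable_const (hS j le_rfl).norm)

lemma pairwise_disjoint_firstExit {Ω : Type*} (S : ℕ → Ω → ℂ) (M : ℝ) :
    Pairwise (Function.onFun Disjoint (firstExit S M)) := by
  have key : ∀ i j, i < j → Disjoint (firstExit S M i) (firstExit S M j) := fun i j hij =>
    Set.disjoint_left.2 fun ω hi hj => (hj.1 i (Finset.mem_range.2 hij)).not_gt hi.2
  intro i j hij
  rcases lt_or_gt_of_ne hij with h | h
  · exact key i j h
  · exact (key j i h).symm

lemma exists_mem_firstExit {Ω : Type*} {S : ℕ → Ω → ℂ} {M : ℝ} {m : ℕ} {ω : Ω}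
    (h : ∃ j ≤ m, M < ‖S j ω‖) : ∃ j ≤ m, ω ∈ firstExit S M j := by
  classical
  have hex : ∃ j, M < ‖S j ω‖ := h.imp fun _ h => h.2
  obtain ⟨j, hj, hjM⟩ := h
  refine ⟨Nat.find hex, (Nat.find_min' hex hjM).trans hj, fun i hi => ?_, Nat.find_spec hex⟩
  exact not_lt.1 (Nat.find_min hex (Finset.mem_range.1 hi))

section UnitRoot

variable {Ω : Type*} [MeasureSpace Ω]

lemma measurable_weightedSum {Ω : Type*} [MeasurableSpace Ω] {ξ : ℤ → Ω → ℝ} (c : ℕ → ℂ)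
    (s : Finset ℕ) (h : ∀ i ∈ s, Measurable (ξ (i + 1))) :
    Measurable fun ω => ∑ i ∈ s, c i * (ξ (i + 1) ω : ℂ) :=
  Finset.measurable_sum _ fun i hi => (Complex.measurable_ofReal.comp (h i hi)).const_mul _

lemma measurableSet_norm_le {Ω : Type*} {m₀ : MeasurableSpace Ω} {f : Ω → ℂ} (L : ℝ)
    (hf : Measurable f) : MeasurableSet {ω | ‖f ω‖ ≤ L} :=
  measurableSet_le hf.norm measurable_const

lemma measure_firstExit_inter [IsProbabilityMeasure (ℙ : Measure Ω)] {ξ : ℤ → Ω → ℝ}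
    (hξ : ∀ i, Measurable (ξ i))
    (hindep : iIndepFun (m := fun _ : ℤ => Real.measurableSpace) ξ (ℙ : Measure Ω))
    (c : ℕ → ℂ) (M L : ℝ) {j m : ℕ} :
    (ℙ : Measure Ω).real (firstExit (fun m ω => ∑ i ∈ Finset.range m, c i * (ξ (i + 1) ω : ℂ)) M j
        ∩ {ω | ‖∑ i ∈ Finset.Ico j m, c i * (ξ (i + 1) ω : ℂ)‖ ≤ L})
      = (ℙ : Measure Ω).real
          (firstExit (fun m ω => ∑ i ∈ Finset.range m, c i * (ξ (i + 1) ω : ℂ)) M j)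
        * (ℙ : Measure Ω).real {ω | ‖∑ i ∈ Finset.Ico j m, c i * (ξ (i + 1) ω : ℂ)‖ ≤ L} := by
  have hi := indep_iSup_of_disjoint (fun i => (hξ i).comap_le) hindep
    (S := Set.Icc 1 (j : ℤ)) (T := Set.Ioi (j : ℤ)) (by
      rw [Set.disjoint_left]
      intro x hx hx'
      exact absurd hx.2 (not_le.2 hx'))
  have h := Indep_iff _ _ _ |>.1 hi
  simp only [measureReal_def]
  rw [h, ENNReal.toReal_mul]
  · refine @measurableSet_firstExit Ω (_) _ M j fun i hij => ?_
    refine @measurable_weightedSum Ω (_) ξ c _ fun a ha => ?_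
    refine Measurable.mono (comap_measurable (ξ (a + 1))) ?_ le_rfl
    have hmem : (a + 1 : ℤ) ∈ Set.Icc 1 (j : ℤ) := by
      rw [Finset.mem_range] at ha
      constructor <;> omega
    exact le_iSup₂_of_le (a + 1 : ℤ) hmem le_rfl
  · refine measurableSet_norm_le (m₀ := _) L ?_
    refine @measurable_weightedSum Ω (_) ξ c _ fun a ha => ?_
    refine Measurable.mono (comap_measurable (ξ (a + 1))) ?_ le_rfl
    have hmem : (a + 1 : ℤ) ∈ Set.Ioi (j : ℤ) := by
      rw [Finset.mem_Ico] at ha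
      show (j : ℤ) < a + 1
      omega
    exact le_iSup₂_of_le (a + 1 : ℤ) hmem le_rfl

/-- Ottaviani's inequality. -/
lemma measureReal_max_le [IsProbabilityMeasure (ℙ : Measure Ω)] {ξ : ℤ → Ω → ℝ}
    (hξ : ∀ i, Measurable (ξ i))
    (hindep : iIndepFun (m := fun _ : ℤ => Real.measurableSpace) ξ (ℙ : Measure Ω))
    (c : ℕ → ℂ) {M η : ℝ} {m : ℕ}
    (h : ∀ j ≤ m, 1 - η ≤
      (ℙ : Measure Ω).real {ω | ‖∑ i ∈ Finset.Ico j m, c i * (ξ (i + 1) ω : ℂ)‖ ≤ M}) :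
    (1 - η) * (ℙ : Measure Ω).real
        {ω | ∃ j ≤ m, 2 * M < ‖∑ i ∈ Finset.range j, c i * (ξ (i + 1) ω : ℂ)‖} ≤ η := by
  set S : ℕ → Ω → ℂ := fun m ω => ∑ i ∈ Finset.range m, c i * (ξ (i + 1) ω : ℂ) with hS_def
  have hS : ∀ i, Measurable (S i) := fun i => measurable_weightedSum c _ fun _ _ => hξ _
  have hE := fun j => measurableSet_firstExit (2 * M) j fun i _ => hS i
  set B : ℕ → Set Ω := fun j => {ω | ‖∑ i ∈ Finset.Ico j m, c i * (ξ (i + 1) ω : ℂ)‖ ≤ M}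
  have hB : ∀ j, MeasurableSet (B j) := fun j =>
    measurableSet_le (measurable_weightedSum c _ fun _ _ => hξ _).norm measurable_const
  have hη : 0 ≤ η := by linarith [h 0 (Nat.zero_le _), measureReal_le_one (μ := (ℙ : Measure Ω)) (s := B 0)]
  rcases le_total (1 - η) 0 with hneg | hpos
  · exact (mul_nonpos_of_nonpos_of_nonneg hneg measureReal_nonneg).trans hη
  have h1 : (ℙ : Measure Ω).real {ω | ∃ j ≤ m, 2 * M < ‖S j ω‖}
      ≤ ∑ j ∈ Finset.range (m + 1), (ℙ : Measure Ω).real (firstExit S (2 * M) j) := by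
    refine (measureReal_mono ?_ (measure_ne_top _ _)).trans
      (measureReal_biUnion_finset_le _ _)
    intro ω hω
    obtain ⟨j, hj, hmem⟩ := exists_mem_firstExit hω
    exact mem_biUnion (Finset.mem_coe.2 (Finset.mem_range.2 (Nat.lt_succ_of_le hj))) hmem
  have h2 : ∑ j ∈ Finset.range (m + 1), (ℙ : Measure Ω).real (firstExit S (2 * M) j ∩ B j)
      ≤ (ℙ : Measure Ω).real (B 0)ᶜ := by
    rw [← measureReal_biUnion_finset
      (fun i _ j _ hij => (pairwise_disjoint_firstExit S (2 * M) hij).mono inter_subset_left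
        inter_subset_left) (fun j _ => (hE j).inter (hB j))]
    refine measureReal_mono (iUnion₂_subset fun j hj ω hω => ?_)
    have hjm : j ≤ m := Nat.lt_succ_iff.1 (Finset.mem_range.1 hj)
    have hsum : S m ω = S j ω + ∑ i ∈ Finset.Ico j m, c i * (ξ (i + 1) ω : ℂ) :=
      (Finset.sum_range_add_sum_Ico _ hjm).symm
    have h3 : 2 * M < ‖S j ω‖ := hω.1.2
    have h4 : ‖∑ i ∈ Finset.Ico j m, c i * (ξ (i + 1) ω : ℂ)‖ ≤ M := hω.2
    show ¬ ‖∑ i ∈ Finset.Ico 0 m, c i * (ξ (i + 1) ω : ℂ)‖ ≤ M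
    have h5 : ‖S j ω‖ ≤ ‖S m ω‖ + ‖∑ i ∈ Finset.Ico j m, c i * (ξ (i + 1) ω : ℂ)‖ := by
      rw [eq_sub_of_add_eq hsum.symm]; exact norm_sub_le _ _
    have h6 : ∑ i ∈ Finset.Ico 0 m, c i * (ξ (i + 1) ω : ℂ) = S m ω := by
      simp only [hS_def, Finset.range_eq_Ico]
    rw [h6]
    linarith
  have h3 : (ℙ : Measure Ω).real (B 0)ᶜ ≤ η := by
    rw [probReal_compl_eq_one_sub (hB 0)]
    linarith [h 0 (Nat.zero_le _)]
  calc _ ≤ (1 - η) * ∑ j ∈ Finset.range (m + 1), (ℙ : Measure Ω).real (firstExit S (2 * M) j) := by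
        gcongr
    _ = ∑ j ∈ Finset.range (m + 1), (ℙ : Measure Ω).real (firstExit S (2 * M) j) * (1 - η) := by
        rw [mul_comm, Finset.sum_mul]
    _ ≤ ∑ j ∈ Finset.range (m + 1), (ℙ : Measure Ω).real (firstExit S (2 * M) j ∩ B j) := by
        refine Finset.sum_le_sum fun j hj => ?_
        rw [measure_firstExit_inter hξ hindep c (2 * M) M]
        exact mul_le_mul_of_nonneg_left (h j (Nat.lt_succ_iff.1 (Finset.mem_range.1 hj)))
          measureReal_nonneg
    _ ≤ η := h2.trans h3

lemma measureReal_forall_abs_le [IsProbabilityMeasure (ℙ : Measure Ω)] {ξ : ℤ → Ω → ℝ}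
    (hξ : ∀ i, Measurable (ξ i))
    (hindep : iIndepFun (m := fun _ : ℤ => Real.measurableSpace) ξ (ℙ : Measure Ω))
    (hident : ∀ i : ℤ, Measure.map (ξ i) (ℙ : Measure Ω) = Measure.map (ξ 1) (ℙ : Measure Ω))
    (M : ℝ) (m : ℕ) :
    (ℙ : Measure Ω).real {ω | ∀ i ∈ Finset.range m, |ξ (i + 1) ω| ≤ M}
      = ((ℙ : Measure Ω).real {ω | |ξ 1 ω| ≤ M}) ^ m := by
  have hM : MeasurableSet {x : ℝ | |x| ≤ M} := measurableSet_le measurable_norm measurable_const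
  set s : Finset ℤ := (Finset.range m).map
    ⟨fun i : ℕ => (i : ℤ) + 1, fun a b h => by simpa using h⟩
  have h := hindep.measure_inter_preimage_eq_mul s (sets := fun _ => {x : ℝ | |x| ≤ M})
    (fun i _ => hM)
  simp only [measureReal_def]
  have h1 : (⋂ i ∈ s, ξ i ⁻¹' {x : ℝ | |x| ≤ M})
      = {ω | ∀ i ∈ Finset.range m, |ξ (i + 1) ω| ≤ M} := by
    ext ω; simp [s]; rfl
  rw [h1] at h
  rw [h, Finset.prod_congr rfl fun i _ => ?_, Finset.prod_const, ENNReal.toReal_pow,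
    Finset.card_map, Finset.card_range]
  rw [← Measure.map_apply (hξ i) hM, hident, Measure.map_apply (hξ 1) hM]
  rfl

/-- A stationary first-order recursion driven by noise with unbounded support has no unit root. -/
lemma false_of_unit_root [IsProbabilityMeasure (ℙ : Measure Ω)] {ξ : ℤ → Ω → ℝ}
    (hξ : ∀ i, Measurable (ξ i))
    (hindep : iIndepFun (m := fun _ : ℤ => Real.measurableSpace) ξ (ℙ : Measure Ω))
    (hident : ∀ i : ℤ, Measure.map (ξ i) (ℙ : Measure Ω) = Measure.map (ξ 1) (ℙ : Measure Ω))
    (htail : ∀ M, 0 < (ℙ : Measure Ω).real {ω | M < |ξ 1 ω|})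
    {W : ℤ → Ω → ℂ} (hW : ∀ i, Measurable (W i))
    (heq : ∀ x i, (ℙ : Measure Ω).real {ω | x < ‖W i ω‖} = (ℙ : Measure Ω).real {ω | x < ‖W 0 ω‖})
    {r : ℂ} (hr : ‖r‖ = 1) (hrec : ∀ i ω, W (i - 1) ω - r * W i ω = ξ i ω) : False := by
  obtain ⟨K, hK⟩ := ((tendsto_measureReal_lt_atTop (hW 0).norm).eventually
    (gt_mem_nhds (show (0 : ℝ) < 1 / 8 by norm_num))).exists
  have htele : ∀ j m : ℕ, j ≤ m → ∀ ω, ∑ i ∈ Finset.Ico j m, r ^ i * (ξ (i + 1) ω : ℂ)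
      = r ^ j * W j ω - r ^ m * W m ω := by
    intro j m hjm ω
    induction m, hjm using Nat.le_induction with
    | base => simp
    | succ m hjm ih =>
      rw [Finset.sum_Ico_succ_top hjm, ih, ← hrec]
      push_cast
      rw [add_sub_cancel_right]
      ring
  have hmax : ∀ m : ℕ, 2 / 3 ≤
      (ℙ : Measure Ω).real {ω | ∀ i ∈ Finset.range m, |ξ (i + 1) ω| ≤ 8 * K} := by
    intro m
    have h := measureReal_max_le hξ hindep (fun i => r ^ i) (M := 2 * K) (η := 1 / 4) (m := m) ?_
    · set G := {ω | ∃ j ≤ m, 2 * (2 * K) < ‖∑ i ∈ Finset.range j, r ^ i * (ξ (i + 1) ω : ℂ)‖}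
      have hG : MeasurableSet G := by
        have : G = ⋃ j ∈ Finset.range (m + 1),
            {ω | 2 * (2 * K) < ‖∑ i ∈ Finset.range j, r ^ i * (ξ (i + 1) ω : ℂ)‖} := by
          ext ω; simp [G]
        rw [this]
        exact Finset.measurableSet_biUnion _ fun j _ => measurableSet_lt measurable_const
          (measurable_weightedSum _ _ fun _ _ => hξ _).norm
      have h1 : Gᶜ ⊆ {ω | ∀ i ∈ Finset.range m, |ξ (i + 1) ω| ≤ 8 * K} := by
        intro ω hω i hi
        simp only [G, mem_compl_iff, mem_ofPred, not_exists, not_and, not_lt] at hω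
        rw [Finset.mem_range] at hi
        have h2 := hω i hi.le
        have h3 := hω (i + 1) hi
        rw [Finset.sum_range_succ] at h3
        have h4 := (norm_le_norm_add_norm_sub' (r ^ i * (ξ (i + 1) ω : ℂ))
          (-∑ i ∈ Finset.range i, r ^ i * (ξ (i + 1) ω : ℂ)))
        rw [norm_neg, sub_neg_eq_add, add_comm (r ^ i * (ξ (i + 1) ω : ℂ)), norm_mul, norm_pow, hr,
          one_pow, one_mul, Complex.norm_real, Real.norm_eq_abs] at h4
        linarith
      have h2 := measureReal_mono (μ := (ℙ : Measure Ω)) h1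
      rw [probReal_compl_eq_one_sub hG] at h2
      linarith
    · intro j hj
      have hm : MeasurableSet {ω | ‖∑ i ∈ Finset.Ico j m, r ^ i * (ξ (i + 1) ω : ℂ)‖ ≤ 2 * K} :=
        measurableSet_le (measurable_weightedSum _ _ fun _ _ => hξ _).norm measurable_const
      have h1 : {ω | ‖∑ i ∈ Finset.Ico j m, r ^ i * (ξ (i + 1) ω : ℂ)‖ ≤ 2 * K}ᶜ
          ⊆ {ω | K < ‖W j ω‖} ∪ {ω | K < ‖W m ω‖} := by
        intro ω hω
        by_contra hcon
        simp only [mem_union, mem_ofPred, not_or, not_lt] at hcon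
        refine hω ?_
        show ‖∑ i ∈ Finset.Ico j m, r ^ i * (ξ (i + 1) ω : ℂ)‖ ≤ 2 * K
        rw [htele j m hj]
        refine (norm_sub_le _ _).trans ?_
        simp only [norm_mul, norm_pow, hr, one_pow, one_mul]
        linarith
      have h2 := (measureReal_mono (μ := (ℙ : Measure Ω)) h1).trans (measureReal_union_le _ _)
      rw [probReal_compl_eq_one_sub hm, heq K j, heq K m] at h2
      linarith
  simp only [measureReal_forall_abs_le hξ hindep hident] at hmax
  have hlt : (ℙ : Measure Ω).real {ω | |ξ 1 ω| ≤ 8 * K} < 1 := by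
    have h := htail (8 * K)
    have h1 : {ω | |ξ 1 ω| ≤ 8 * K} = {ω | 8 * K < |ξ 1 ω|}ᶜ := by ext ω; simp
    have h2 : MeasurableSet {ω | 8 * K < |ξ 1 ω|} :=
      measurableSet_lt measurable_const (hξ 1).norm
    rw [h1, probReal_compl_eq_one_sub h2]
    linarith
  have := ge_of_tendsto' (tendsto_pow_atTop_nhds_zero_of_lt_one measureReal_nonneg hlt) hmax
  norm_num at this

end UnitRoot

/-- the autoregressive characteristic polynomial -/
def arPoly {p : ℕ} (φc : Fin p → ℝ) : Polynomial ℂ :=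
  1 - ∑ j : Fin p, Polynomial.C (φc j : ℂ) * Polynomial.X ^ ((j : ℕ) + 1)

section Autoregression

variable {Ω : Type*} {p : ℕ} {φc : Fin p → ℝ} {X ξ : ℤ → Ω → ℝ}

lemma eval_arPoly (z : ℂ) :
    (arPoly φc).eval z = 1 - ∑ j : Fin p, (φc j : ℂ) * z ^ ((j : ℕ) + 1) := by
  simp [arPoly, Polynomial.eval_finsetSum]

lemma arPoly_ne_zero : arPoly φc ≠ 0 := by
  intro h
  have := eval_arPoly (φc := φc) 0
  simp [h] at this

lemma linFilter_arPoly
    (hmodel : ∀ (i : ℤ) ω, X i ω = ∑ j : Fin p, φc j * X (i - ((j : ℕ) + 1)) ω + ξ i ω)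
    (i : ℤ) (ω : Ω) : linFilter (arPoly φc) (fun j ω => (X j ω : ℂ)) i ω = ξ i ω := by
  have h1 : ∀ j : Fin p, linFilter (Polynomial.C (φc j : ℂ) * Polynomial.X ^ ((j : ℕ) + 1))
      (fun j ω => (X j ω : ℂ)) i ω = φc j * X (i - ((j : ℕ) + 1)) ω := by
    intro j
    rw [linFilter_mul, linFilter_C]
    simp [linFilter, lagOp_pow_apply]
  have h2 : linFilter (arPoly φc) (fun j ω => (X j ω : ℂ)) i ω
      = X i ω - ∑ j : Fin p, linFilter (Polynomial.C (φc j : ℂ) * Polynomial.X ^ ((j : ℕ) + 1))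
        (fun j ω => (X j ω : ℂ)) i ω := by
    simp only [linFilter, arPoly, map_sub, map_one, map_sum, LinearMap.sub_apply,
      Module.End.one_apply, LinearMap.sum_apply, Pi.sub_apply, Finset.sum_apply]
  rw [h2, Finset.sum_congr rfl fun j _ => h1 j, hmodel i ω]
  push_cast
  ring

variable [MeasureSpace Ω]

lemma tailDF_map_abs {Y : Ω → ℝ} (hY : Measurable Y) (x : ℝ) :
    (ℙ : Measure Ω).real {ω | x < |Y ω|} = tailDF (Measure.map (fun ω => |Y ω|) ℙ) x :=
  measureReal_lt_eq_tailDF hY.norm x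

lemma measureReal_abs_eq (hξ : ∀ i, Measurable (ξ i))
    (hident : ∀ i : ℤ, Measure.map (ξ i) (ℙ : Measure Ω) = Measure.map (ξ 1) (ℙ : Measure Ω))
    (i : ℤ) (x : ℝ) :
    (ℙ : Measure Ω).real {ω | x < |ξ i ω|} = tailDF (Measure.map (fun ω => |ξ 1 ω|) ℙ) x := by
  rw [tailDF_map_abs (hξ i)]
  have h : ∀ i, Measure.map (fun ω => |ξ i ω|) (ℙ : Measure Ω)
      = (Measure.map (ξ i) ℙ).map (fun x => |x|) := fun i =>
    (Measure.map_map measurable_norm (hξ i)).symm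
  rw [h i, h 1, hident i]

/-- The marginal law of a stationary autoregression has a tail of at most the order of the tail of
the innovations. -/
lemma exists_tail_bound [IsProbabilityMeasure (ℙ : Measure Ω)]
    (hXmeas : ∀ i, Measurable (X i)) (hξmeas : ∀ i, Measurable (ξ i))
    (hmodel : ∀ (i : ℤ) ω, X i ω = ∑ j : Fin p, φc j * X (i - ((j : ℕ) + 1)) ω + ξ i ω)
    (hchar : ∀ z : ℂ, ‖z‖ < 1 →
      (1 : ℂ) - ∑ j : Fin p, (φc j : ℂ) * z ^ ((j : ℕ) + 1) ≠ 0)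
    (hstat : IsStationaryZ X)
    (hindep : iIndepFun (m := fun _ : ℤ => Real.measurableSpace) ξ (ℙ : Measure Ω))
    (hident : ∀ i : ℤ, Measure.map (ξ i) (ℙ : Measure Ω) = Measure.map (ξ 1) (ℙ : Measure Ω))
    {α : ℝ} (hα : 0 < α) {l : ℝ → ℝ}
    (hP : ParetoTail (Measure.map (fun ω => |ξ 1 ω|) (ℙ : Measure Ω)) α l) :
    ∃ C c x₀ : ℝ, 0 ≤ C ∧ 0 < c ∧ ∀ i, ∀ x ≥ x₀, (ℙ : Measure Ω).real {ω | x < |X i ω|}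
      ≤ C * tailDF (Measure.map (fun ω => |ξ 1 ω|) ℙ) (c * x) := by
  have : IsProbabilityMeasure (Measure.map (fun ω => |ξ 1 ω|) (ℙ : Measure Ω)) :=
    Measure.isProbabilityMeasure_map (hξmeas 1).norm.aemeasurable
  have hXc : ∀ i, Measurable fun ω => (X i ω : ℂ) := fun i =>
    Complex.measurable_ofReal.comp (hXmeas i)
  have hroot : ∀ r, (arPoly φc).IsRoot r → 1 < ‖r‖ := by
    intro r hr
    by_contra! hle
    rcases hle.lt_or_eq with hlt | heq
    · exact hchar r hlt (by rw [← eval_arPoly]; exact hr)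
    · obtain ⟨Q, hQ⟩ := Polynomial.dvd_iff_isRoot.2 hr
      refine false_of_unit_root hξmeas hindep hident (fun M => ?_)
        (W := linFilter Q (fun j ω => (X j ω : ℂ))) (fun i => measurable_linFilter Q hXc i)
        (fun x i => hstat.measureReal_linFilter hXmeas Q x i) heq (fun i ω => ?_)
      · rw [tailDF_map_abs (hξmeas 1)]; exact hP.tailDF_pos M
      · rw [← linFilter_X_sub_C, ← linFilter_mul, ← hQ, linFilter_arPoly hmodel]
  have hbase : TailDominated (Measure.map (fun ω => |ξ 1 ω|) (ℙ : Measure Ω))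
      (linFilter (arPoly φc * 1) (fun j ω => (X j ω : ℂ)) 0) := by
    refine ⟨1, 1, 0, zero_le_one, one_pos, fun x _ => ?_⟩
    simp only [mul_one, linFilter_arPoly hmodel, Complex.norm_real, Real.norm_eq_abs, one_mul,
      measureReal_abs_eq hξmeas hident, le_refl]
  obtain ⟨C, c, x₀, hC, hc, h⟩ := TailDominated.of_linFilter hP hα hstat hXmeas 1 (arPoly φc)
    arPoly_ne_zero hroot hbase
  refine ⟨C, c, x₀, hC, hc, fun i x hx => ?_⟩
  have h1 := h x hx
  rw [← hstat.measureReal_linFilter hXmeas 1 x i, linFilter_one] at h1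
  simpa using h1

end Autoregression

section CharacteristicFunction

open Complex

lemma norm_exp_sub_quadratic_le {z : ℂ} (hz : ‖z‖ ≤ 1) :
    ‖exp z - 1 - z - z ^ 2 / 2‖ ≤ ‖z‖ ^ 3 := by
  have h := Complex.exp_bound hz (n := 3) (by norm_num)
  norm_num [Finset.sum_range_succ, Nat.factorial] at h
  refine le_trans (le_of_eq ?_) (h.trans ?_)
  · congr 1; ring
  · nlinarith [pow_nonneg (norm_nonneg z) 3]

/-- The characteristic function of a centred and scaled binomial variable whose success probability
is of smaller order converges to a Gaussian one. -/
lemma tendsto_charFun_binomial {k : ℕ → ℕ} (hk : TailFraction k) {p : ℕ → ℝ} {a : ℝ}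
    (hp : Tendsto (fun n : ℕ => Real.sqrt (k n) * ((n : ℝ) / k n * p n - 1)) atTop (nhds a))
    (u : ℝ) :
    Tendsto (fun n : ℕ => ((1 + p n * (exp ((u / Real.sqrt (k n) : ℝ) * I) - 1))
      * exp (-(u * (Real.sqrt (k n) / n) : ℝ) * I)) ^ n) atTop
      (nhds (exp (u * a * I - u ^ 2 / 2))) := by
  set s : ℕ → ℝ := fun n => Real.sqrt (k n)
  have hs : Tendsto s atTop atTop := hk.tendsto_sqrt
  have hs2 : ∀ n, s n * s n = k n := fun n => Real.mul_self_sqrt (Nat.cast_nonneg _)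
  set A : ℕ → ℝ := fun n => s n * ((n : ℝ) / k n * p n - 1)
  set E : ℕ → ℂ := fun n => exp ((u / s n : ℝ) * I) - 1
  set F : ℕ → ℂ := fun n => exp (-(u * (s n / n) : ℝ) * I) - 1
  have hus : Tendsto (fun n => u / s n) atTop (nhds 0) := hs.const_div_atTop u
  have huq : Tendsto (fun n : ℕ => u * (s n / n)) atTop (nhds 0) := by
    simpa using hk.tendsto_sqrt_div.const_mul u
  have hpos : ∀ᶠ n : ℕ in atTop, 0 < s n ∧ (0 : ℝ) < n := by
    filter_upwards [hs.eventually (eventually_gt_atTop 0), eventually_gt_atTop 0] with n h1 h2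
    exact ⟨h1, by exact_mod_cast h2⟩
  have hsmall : ∀ {f : ℕ → ℝ}, Tendsto f atTop (nhds 0) → ∀ᶠ n in atTop, |f n| ≤ 1 := fun h =>
    (h.abs.eventually (ge_mem_nhds (by simp))).mono fun _ h => h
  have hE2 : Tendsto (fun n => (s n : ℂ) ^ 2 * E n - u * s n * I) atTop (nhds (-(u : ℂ) ^ 2 / 2)) := by
    rw [← tendsto_sub_nhds_zero_iff]
    refine squeeze_zero_norm' (a := fun n => |u| ^ 3 / s n) ?_ (hs.const_div_atTop _)
    filter_upwards [hpos, hsmall hus] with n ⟨hn, _⟩ h1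
    have hz : ‖((u / s n : ℝ) : ℂ) * I‖ = |u| / s n := by
      simp [abs_of_pos hn]
    have h2 := norm_exp_sub_quadratic_le (z := ((u / s n : ℝ) : ℂ) * I) (by
      rw [hz]; rwa [abs_div, abs_of_pos hn] at h1)
    have hsc : (s n : ℂ) ≠ 0 := by exact_mod_cast hn.ne'
    have h3 : (s n : ℂ) ^ 2 * E n - u * s n * I - -(u : ℂ) ^ 2 / 2
        = (s n : ℂ) ^ 2 * (exp (((u / s n : ℝ) : ℂ) * I) - 1 - ((u / s n : ℝ) : ℂ) * I
          - (((u / s n : ℝ) : ℂ) * I) ^ 2 / 2) := by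
      simp only [E, mul_pow, I_sq]
      push_cast
      field_simp
    rw [h3, norm_mul, norm_pow, norm_real, Real.norm_eq_abs, abs_of_pos hn]
    rw [hz] at h2
    calc s n ^ 2 * _ ≤ s n ^ 2 * (|u| / s n) ^ 3 := by gcongr
      _ = |u| ^ 3 / s n := by field_simp
  have hE1 : Tendsto (fun n => (s n : ℂ) * E n) atTop (nhds (u * I)) := by
    have hinv : Tendsto (fun n => ((s n)⁻¹ : ℝ) : ℕ → ℂ) atTop (nhds 0) := by
      exact_mod_cast (continuous_ofReal.tendsto 0).comp hs.inv_tendsto_atTop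
    have h := (hE2.mul hinv).add_const (u * I)
    rw [mul_zero, zero_add] at h
    refine h.congr' ?_
    filter_upwards [hpos] with n ⟨hn, _⟩
    have hsc : (s n : ℂ) ≠ 0 := by exact_mod_cast hn.ne'
    push_cast
    field_simp
    ring
  have hF1 : Tendsto (fun n => (s n : ℂ) * F n) atTop (nhds 0) := by
    refine squeeze_zero_norm' (a := fun n => 2 * |u| * ((k n : ℝ) / n)) ?_
      (by simpa using hk.2.const_mul (2 * |u|))
    filter_upwards [hpos, hsmall huq] with n ⟨hn, hn'⟩ h1
    have hz : ‖-((u * (s n / n) : ℝ) : ℂ) * I‖ = |u * (s n / n)| := by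
      rw [norm_mul, norm_neg, norm_I, mul_one, norm_real, Real.norm_eq_abs]
    have h2 := Complex.norm_exp_sub_one_le (hz.trans_le h1)
    rw [norm_mul, norm_real, Real.norm_eq_abs, abs_of_pos hn]
    rw [hz, abs_mul, abs_of_pos (div_pos hn hn')] at h2
    calc s n * ‖F n‖ ≤ s n * (2 * (|u| * (s n / n))) := by gcongr
      _ = 2 * |u| * ((k n : ℝ) / n) := by rw [← hs2]; ring
  have hF2 : Tendsto (fun n : ℕ => (n : ℂ) * F n + u * s n * I) atTop (nhds 0) := by
    refine squeeze_zero_norm' (a := fun n => u ^ 2 * ((k n : ℝ) / n)) ?_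
      (by simpa using hk.2.const_mul (u ^ 2))
    filter_upwards [hpos, hsmall huq] with n ⟨hn, hn'⟩ h1
    have hz : ‖-((u * (s n / n) : ℝ) : ℂ) * I‖ = |u * (s n / n)| := by
      rw [norm_mul, norm_neg, norm_I, mul_one, norm_real, Real.norm_eq_abs]
    have h2 := Complex.norm_exp_sub_one_sub_id_le (hz.trans_le h1)
    have hnc : (n : ℂ) ≠ 0 := by exact_mod_cast hn'.ne'
    have h3 : (n : ℂ) * F n + u * s n * I = n * (exp (-((u * (s n / n) : ℝ) : ℂ) * I) - 1
        - -((u * (s n / n) : ℝ) : ℂ) * I) := by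
      simp only [F]
      push_cast
      field_simp
      ring
    rw [h3, norm_mul, Complex.norm_natCast]
    rw [hz, sq_abs] at h2
    calc (n : ℝ) * _ ≤ n * (u * (s n / n)) ^ 2 := by gcongr
      _ = u ^ 2 * ((k n : ℝ) / n) := by rw [← hs2]; field_simp
  have hA : Tendsto (fun n => (A n : ℂ)) atTop (nhds a) := (continuous_ofReal.tendsto a).comp hp
  have hAs : Tendsto (fun n => 1 + (A n : ℂ) * ((s n)⁻¹ : ℝ)) atTop (nhds 1) := by
    have hinv : Tendsto (fun n => ((s n)⁻¹ : ℝ) : ℕ → ℂ) atTop (nhds 0) := by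
      exact_mod_cast (continuous_ofReal.tendsto 0).comp hs.inv_tendsto_atTop
    simpa using (hA.mul hinv).const_add 1
  have hlim : Tendsto (fun n : ℕ => (n : ℂ) * ((1 + p n * E n) * (1 + F n) - 1)) atTop
      (nhds (u * a * I - u ^ 2 / 2)) := by
    have h := ((hE2.add (hA.mul hE1)).add hF2).add ((hAs.mul hE1).mul hF1)
    have h0 : -(u : ℂ) ^ 2 / 2 + a * (u * I) + 0 + 1 * (u * I) * 0 = u * a * I - u ^ 2 / 2 := by ring
    rw [h0] at h
    refine h.congr' ?_
    filter_upwards [hpos] with n ⟨hn, hn'⟩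
    have hsc : (s n : ℂ) ≠ 0 := by exact_mod_cast hn.ne'
    have hnp : (n : ℂ) * p n = s n ^ 2 + A n * s n := by
      have : (n : ℝ) * p n = s n ^ 2 + A n * s n := by
        simp only [A]
        rw [← hs2]
        field_simp
        ring
      exact_mod_cast this
    have h1 : (n : ℂ) * ((1 + p n * E n) * (1 + F n) - 1)
        = n * F n + (n * p n) * E n + (n * p n) * E n * F n := by ring
    rw [h1, hnp]
    push_cast
    field_simp
    ring
  refine (tendsto_one_add_pow_exp_of_tendsto hlim).congr fun n => ?_
  congr 1
  simp only [E, F]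
  ring

lemma charFun_map_indicator {Ω : Type*} [MeasurableSpace Ω] {P : Measure Ω}
    [IsProbabilityMeasure P] {A : Set Ω} (hA : MeasurableSet A) (t : ℝ) :
    charFun (P.map (A.indicator fun _ => (1 : ℝ))) t = 1 + P.real A * (exp (t * I) - 1) := by
  rw [charFun_apply_real, integral_map (measurable_const.indicator hA).aemeasurable
    (by fun_prop)]
  have h : ∀ ω, exp (t * (A.indicator (fun _ => (1 : ℝ)) ω : ℝ) * I)
      = 1 + A.indicator (fun _ => exp (t * I) - 1) ω := by
    intro ω
    by_cases hω : ω ∈ A <;> simp [hω]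
  simp only [h]
  rw [integral_add (integrable_const _) ((integrable_const _).indicator hA),
    integral_indicator_const _ hA]
  simp

end CharacteristicFunction

/-- the number of indices `1 ≤ i ≤ n` for which `Y i` exceeds `c` -/
def exceedCount {Ω : Type*} (n : ℕ) (c : ℝ) (Y : ℕ → Ω → ℝ) (ω : Ω) : ℕ :=
  ((Finset.Icc 1 n).filter fun i => c < Y i ω).card

lemma exceedCount_eq_sum {Ω : Type*} (n : ℕ) (c : ℝ) (Y : ℕ → Ω → ℝ) (ω : Ω) :
    (exceedCount n c Y ω : ℝ)
      = ∑ i ∈ Finset.Icc 1 n, {ω | c < Y i ω}.indicator (fun _ => (1 : ℝ)) ω := by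
  rw [exceedCount, Finset.card_filter]
  push_cast
  exact Finset.sum_congr rfl fun i _ => by simp [indicator_apply]

lemma measurable_exceedCount {Ω : Type*} [MeasurableSpace Ω] (n : ℕ) (c : ℝ) {Y : ℕ → Ω → ℝ}
    (hY : ∀ i, Measurable (Y i)) : Measurable fun ω => (exceedCount n c Y ω : ℝ) := by
  simp only [exceedCount_eq_sum]
  exact Finset.measurable_sum _ fun i _ =>
    measurable_const.indicator (measurableSet_lt measurable_const (hY i))

section Counting

variable {Ω : Type*} [MeasureSpace Ω] [IsProbabilityMeasure (ℙ : Measure Ω)] {Y : ℕ → Ω → ℝ}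

lemma charFun_map_exceedCount (hY : ∀ i, Measurable (Y i))
    (hindep : iIndepFun (m := fun _ : ℕ => Real.measurableSpace) Y (ℙ : Measure Ω))
    {T : ℝ → ℝ} (hT : ∀ i c, (ℙ : Measure Ω).real {ω | c < Y i ω} = T c) (n : ℕ) (c u : ℝ) :
    charFun (Measure.map (fun ω => (exceedCount n c Y ω : ℝ)) (ℙ : Measure Ω)) u
      = (1 + T c * (Complex.exp (u * Complex.I) - 1)) ^ n := by
  have hm : ∀ i, MeasurableSet {ω | c < Y i ω} := fun i => measurableSet_lt measurable_const (hY i)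
  have hind : iIndepFun (m := fun _ : ℕ => Real.measurableSpace)
      (fun i => {ω | c < Y i ω}.indicator fun _ => (1 : ℝ)) (ℙ : Measure Ω) :=
    hindep.comp (fun _ => (Ioi c).indicator fun _ => (1 : ℝ))
      (fun _ => measurable_const.indicator measurableSet_Ioi)
  simp only [exceedCount_eq_sum]
  rw [(hind.restrict _).charFun_map_fun_finsetSum_eq_prod
    (fun i _ => (measurable_const.indicator (hm i)).aemeasurable)]
  simp [charFun_map_indicator (hm _), hT]

/-- Central limit theorem for the number of exceedances over a high threshold. -/
lemma tendsto_measureReal_exceedCount (hY : ∀ i, Measurable (Y i))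
    (hindep : iIndepFun (m := fun _ : ℕ => Real.measurableSpace) Y (ℙ : Measure Ω))
    {T : ℝ → ℝ} (hT : ∀ i c, (ℙ : Measure Ω).real {ω | c < Y i ω} = T c)
    {k : ℕ → ℕ} (hk : TailFraction k) {c : ℕ → ℝ} {a : ℝ}
    (hc : Tendsto (fun n : ℕ => Real.sqrt (k n) * ((n : ℝ) / k n * T (c n) - 1)) atTop (nhds a))
    (δ : ℝ) :
    Tendsto (fun n : ℕ => (ℙ : Measure Ω).real
      {ω | (exceedCount n (c n) Y ω : ℝ) < k n - δ * Real.sqrt (k n)}) atTop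
      (nhds (cdf (gaussianReal 0 1) (-a - δ))) := by
  set s : ℕ → ℝ := fun n => Real.sqrt (k n)
  set V : ℕ → Ω → ℝ := fun n ω => (s n)⁻¹ * (exceedCount n (c n) Y ω : ℝ) + -s n
  have hN : ∀ n, Measurable fun ω => (exceedCount n (c n) Y ω : ℝ) := fun n =>
    measurable_exceedCount n _ hY
  have hV : ∀ n, Measurable (V n) := fun n => ((hN n).const_mul _).add_const _
  let μ : ℕ → ProbabilityMeasure ℝ := fun n =>
    ⟨Measure.map (V n) ℙ, Measure.isProbabilityMeasure_map (hV n).aemeasurable⟩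
  let ν : ProbabilityMeasure ℝ := ⟨gaussianReal a 1, inferInstance⟩
  have hchar : ∀ n, 0 < n → ∀ u, charFun (Measure.map (V n) (ℙ : Measure Ω)) u
      = ((1 + (T (c n) : ℝ) * (Complex.exp ((u / Real.sqrt (k n) : ℝ) * Complex.I) - 1))
      * Complex.exp (-(u * (Real.sqrt (k n) / n) : ℝ) * Complex.I)) ^ n := by
    intro n hn u
    have h1 : Measure.map (V n) (ℙ : Measure Ω)
        = (Measure.map (fun ω => (s n)⁻¹ * (exceedCount n (c n) Y ω : ℝ)) ℙ).map (· + -s n) :=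
      (Measure.map_map (measurable_id.add_const _) ((hN n).const_mul _)).symm
    rw [h1, charFun_map_add_const, charFun_map_mul_comp (hN n).aemeasurable,
      charFun_map_exceedCount hY hindep hT, mul_pow, ← Complex.exp_nat_mul]
    have hnc : (n : ℂ) ≠ 0 := by exact_mod_cast hn.ne'
    have h2 : (s n)⁻¹ * u = u / Real.sqrt (k n) := (div_eq_inv_mul _ _).symm
    rw [h2]
    congr 2
    · simp only [RCLike.inner_apply, conj_trivial, s]
      push_cast
      field_simp
  have hconv : Tendsto μ atTop (nhds ν) := by
    refine ProbabilityMeasure.tendsto_iff_tendsto_charFun.2 fun u => ?_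
    have h := tendsto_charFun_binomial hk hc u
    have h2 : charFun (ν : Measure ℝ) u = Complex.exp (u * a * Complex.I - u ^ 2 / 2) := by
      show charFun (gaussianReal a 1) u = _
      rw [charFun_gaussianReal]
      simp
    rw [h2]
    refine h.congr' ?_
    filter_upwards [eventually_gt_atTop 0] with n hn
    exact (hchar n hn u).symm
  have hset := ProbabilityMeasure.tendsto_measure_of_null_frontier_of_tendsto' hconv
    (E := Iio (-δ)) (by
      rw [frontier_Iio]
      have := nullSingletonClass_gaussianReal (μ := a) (v := 1) one_ne_zero
      exact measure_singleton (μ := gaussianReal a 1) (-δ))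
  have hreal := (ENNReal.tendsto_toReal (measure_ne_top _ _)).comp hset
  have hlim : ((ν : Measure ℝ) (Iio (-δ))).toReal = cdf (gaussianReal 0 1) (-a - δ) := by
    have := nullSingletonClass_gaussianReal (μ := 0) (v := 1) one_ne_zero
    rw [cdf_eq_real, measureReal_congr Iio_ae_eq_Iic.symm]
    show ((gaussianReal a 1) (Iio (-δ))).toReal = _
    have h1 : gaussianReal a 1 = (gaussianReal 0 1).map (· + a) := by
      rw [gaussianReal_map_add_const, zero_add]
    rw [h1, Measure.map_apply (by fun_prop : Measurable fun x : ℝ => x + a) measurableSet_Iio,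
      measureReal_def]
    congr 2
    ext x
    simp only [mem_preimage, mem_Iio]
    constructor <;> intro h <;> linarith
  rw [hlim] at hreal
  refine hreal.congr' ?_
  filter_upwards [hk.tendsto_sqrt.eventually (eventually_gt_atTop 0)] with n hn
  show (Measure.map (V n) (ℙ : Measure Ω) (Iio (-δ))).toReal = _
  rw [Measure.map_apply (hV n) measurableSet_Iio, measureReal_def]
  congr 2
  ext ω
  have hs2 : s n * s n = k n := Real.mul_self_sqrt (Nat.cast_nonneg _)
  have hn' : 0 < s n := hn
  simp only [V, mem_preimage, mem_Iio, mem_ofPred]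
  rw [← sub_eq_add_neg, sub_lt_iff_lt_add, inv_mul_lt_iff₀ hn']
  have h1 : s n * (-δ + s n) = k n - δ * s n := by rw [← hs2]; ring
  rw [h1]

end Counting

lemma continuous_cdf (μ : Measure ℝ) [IsProbabilityMeasure μ] (hμ : ∀ x, μ {x} = 0) :
    Continuous (cdf μ) := by
  refine continuous_iff_continuousAt.2 fun x => ?_
  rw [(monotone_cdf μ).continuousAt_iff_leftLim_eq_rightLim, (cdf μ).rightLim_eq]
  have h := (cdf μ).measure_singleton x
  rw [measure_cdf, hμ, eq_comm, ENNReal.ofReal_eq_zero] at h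
  exact le_antisymm ((monotone_cdf μ).leftLim_le le_rfl) (by linarith)

lemma continuous_cdf_gaussianReal (m : ℝ) {v : NNReal} (hv : v ≠ 0) :
    Continuous (cdf (gaussianReal m v)) := by
  have := nullSingletonClass_gaussianReal (μ := m) hv
  exact continuous_cdf _ fun x => measure_singleton x

lemma cdf_gaussianReal_inv_sq {α : ℝ} (hα : 0 < α) (t : ℝ) :
    cdf (gaussianReal 0 (Real.toNNReal (α⁻¹ ^ 2))) t = cdf (gaussianReal 0 1) (α * t) := by
  have h : gaussianReal 0 (Real.toNNReal (α⁻¹ ^ 2)) = (gaussianReal 0 1).map (α⁻¹ * ·) := by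
    rw [gaussianReal_map_const_mul, mul_zero, mul_one]
    congr 1
    exact Real.toNNReal_of_nonneg (sq_nonneg _)
  rw [cdf_eq_real, cdf_eq_real, h, map_measureReal_apply (by fun_prop) measurableSet_Iic]
  congr 1
  ext x
  simp only [mem_preimage, mem_Iic]
  rw [inv_mul_le_iff₀ hα]

/-- Pointwise convergence of distribution functions implies convergence in law. -/
lemma tendstoInLaw_of_tendsto_cdf {Ω : Type*} [MeasureSpace Ω]
    [IsProbabilityMeasure (ℙ : Measure Ω)] {Y : ℕ → Ω → ℝ} (hY : ∀ n, Measurable (Y n))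
    (ν : Measure ℝ) [IsProbabilityMeasure ν]
    (h : ∀ t, Tendsto (fun n => (ℙ : Measure Ω).real {ω | Y n ω ≤ t}) atTop (nhds (cdf ν t))) :
    TendstoInLaw Y ν := by
  let μ : ℕ → ProbabilityMeasure ℝ := fun n =>
    ⟨Measure.map (Y n) ℙ, Measure.isProbabilityMeasure_map (hY n).aemeasurable⟩
  let ν' : ProbabilityMeasure ℝ := ⟨ν, inferInstance⟩
  have hIoc : ∀ (ρ : Measure ℝ) [IsProbabilityMeasure ρ] {a b : ℝ}, a ≤ b →
      ρ.real (Ioc a b) = cdf ρ b - cdf ρ a := by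
    intro ρ _ a b hab
    rw [cdf_eq_real, cdf_eq_real, ← Iic_sdiff_Iic,
      measureReal_sdiff (Iic_subset_Iic.2 hab) measurableSet_Iic]
  have hcdf : ∀ n t, cdf (μ n : Measure ℝ) t = (ℙ : Measure Ω).real {ω | Y n ω ≤ t} := by
    intro n t
    rw [cdf_eq_real]
    exact map_measureReal_apply (hY n) measurableSet_Iic
  have hconv : Tendsto μ atTop (nhds ν') := by
    refine (isPiSystem_Ioc (id : ℝ → ℝ) id).tendsto_probabilityMeasure_of_tendsto_of_mem ?_ ?_ ?_
    · rintro s ⟨a, b, -, rfl⟩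
      exact measurableSet_Ioc
    · intro u hu x hx
      obtain ⟨ε, hε, hball⟩ := Metric.isOpen_iff.1 hu x hx
      refine ⟨Ioc (x - ε / 2) (x + ε / 2), ⟨x - ε / 2, x + ε / 2, ?_, rfl⟩,
        Ioc_mem_nhds (by linarith) (by linarith), fun y hy => hball ?_⟩
      · simp only [id]; linarith
      · rw [Metric.mem_ball, Real.dist_eq, abs_lt]
        constructor <;> linarith [hy.1, hy.2]
    · rintro s ⟨a, b, hab, rfl⟩
      rw [← NNReal.tendsto_coe]
      have h1 : ((ν' (Ioc (id a) (id b)) : NNReal) : ℝ) = cdf ν b - cdf ν a := hIoc ν hab.le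
      have h2 : ∀ n, ((μ n (Ioc (id a) (id b)) : NNReal) : ℝ)
          = (ℙ : Measure Ω).real {ω | Y n ω ≤ b} - (ℙ : Measure Ω).real {ω | Y n ω ≤ a} := by
        intro n
        rw [← hcdf, ← hcdf]
        exact hIoc (μ n : Measure ℝ) hab.le
      simp only [h1, h2]
      exact (h b).sub (h a)
  intro f hf hC
  obtain ⟨C, hC⟩ := hC
  have := ProbabilityMeasure.tendsto_iff_forall_integral_tendsto.1 hconv
    (BoundedContinuousFunction.ofNormedAddCommGroup f hf C hC)
  refine this.congr fun n => ?_
  exact integral_map (hY n).aemeasurable hf.aestronglyMeasurable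

section OrderStat

variable {Ω : Type*} {Y : ℕ → Ω → ℝ}

lemma orderStat_le_iff {n k : ℕ} (hk : 0 < k) (hkn : k ≤ n) (x : ℝ) (ω : Ω) :
    orderStat n k Y ω ≤ x ↔ exceedCount n x Y ω < k := by
  have hne : (Finset.Icc 1 n).Nonempty := Finset.nonempty_Icc.2 (by omega)
  have hbdd : BddBelow {x : ℝ | exceedCount n x Y ω < k} := by
    refine ⟨(Finset.Icc 1 n).inf' hne fun i => Y i ω, fun y hy => ?_⟩
    by_contra! hlt
    have hall : (Finset.Icc 1 n).filter (fun i => y < Y i ω) = Finset.Icc 1 n :=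
      Finset.filter_true_of_mem fun i hi => hlt.trans_le (Finset.inf'_le _ hi)
    have hy' : ((Finset.Icc 1 n).filter fun i => y < Y i ω).card < k := hy
    rw [hall, Nat.card_Icc] at hy'
    omega
  have hnonempty : {x : ℝ | exceedCount n x Y ω < k}.Nonempty := by
    refine ⟨(Finset.Icc 1 n).sup' hne fun i => Y i ω, ?_⟩
    show ((Finset.Icc 1 n).filter _).card < k
    rw [Finset.filter_false_of_mem fun i hi => not_lt.2 (Finset.le_sup' (fun i => Y i ω) hi)]
    simpa using hk
  constructor
  · contrapose!
    intro hx
    set F := (Finset.Icc 1 n).filter fun i => x < Y i ω with hF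
    have hcard : k ≤ F.card := hx
    have hFne : F.Nonempty := Finset.card_pos.1 (by omega)
    have hxF : x < F.inf' hFne fun i => Y i ω :=
      (Finset.lt_inf'_iff hFne).2 fun i hi => (Finset.mem_filter.1 hi).2
    refine hxF.trans_le (le_csInf hnonempty fun y hy => ?_)
    by_contra! hlt
    have hsub : F ⊆ (Finset.Icc 1 n).filter fun i => y < Y i ω := fun i hi =>
      Finset.mem_filter.2 ⟨(Finset.mem_filter.1 hi).1, hlt.trans_le (Finset.inf'_le _ hi)⟩
    have hy' : ((Finset.Icc 1 n).filter fun i => y < Y i ω).card < k := hy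
    have := Finset.card_le_card hsub
    omega
  · exact fun hx => csInf_le hbdd hx

lemma measurable_orderStat [MeasurableSpace Ω] (n k : ℕ) (hY : ∀ i, Measurable (Y i)) :
    Measurable (orderStat n k Y) := by
  rcases Nat.eq_zero_or_pos k with rfl | hk
  · have : orderStat n 0 Y = fun _ => (0 : ℝ) := by
      funext ω
      simp [orderStat]
    rw [this]
    exact measurable_const
  rcases lt_or_ge n k with hnk | hkn
  · have : orderStat n k Y = fun _ => (0 : ℝ) := by
      funext ω
      have huniv : {x : ℝ | ((Finset.Icc 1 n).filter fun i => x < Y i ω).card < k} = univ := by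
        refine eq_univ_of_forall fun x => ?_
        show ((Finset.Icc 1 n).filter _).card < k
        refine (Finset.card_filter_le _ _).trans_lt ?_
        rw [Nat.card_Icc]
        omega
      rw [orderStat, huniv, Real.sInf_univ]
    rw [this]
    exact measurable_const
  refine measurable_of_Iic fun x => ?_
  have : orderStat n k Y ⁻¹' Iic x = {ω | (exceedCount n x Y ω : ℝ) < k} := by
    ext ω
    simp only [mem_preimage, mem_Iic, mem_ofPred, orderStat_le_iff hk hkn, Nat.cast_lt]
  rw [this]
  exact measurableSet_lt (measurable_exceedCount n x hY) measurable_const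

end OrderStat

section Comparison

variable {Ω : Type*}

lemma exceedCount_le_add (n : ℕ) {c c' η : ℝ} (h : c + η ≤ c') (Y Y' : ℕ → Ω → ℝ) (ω : Ω) :
    exceedCount n c' Y' ω
      ≤ exceedCount n c Y ω + exceedCount n η (fun i ω => |Y' i ω - Y i ω|) ω := by
  refine (Finset.card_le_card fun i hi => ?_).trans (Finset.card_union_le _ _)
  obtain ⟨hi, hlt⟩ := Finset.mem_filter.1 hi
  rw [Finset.mem_union, Finset.mem_filter, Finset.mem_filter]
  by_cases hc : c < Y i ω
  · exact Or.inl ⟨hi, hc⟩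
  · exact Or.inr ⟨hi, lt_of_lt_of_le (by linarith) (le_abs_self _)⟩

lemma exceedCount_le_sum (n p : ℕ) {η θ r : ℝ} (hr : 0 ≤ r) (hθ : r * (p * θ) ≤ η)
    {D : ℕ → Ω → ℝ} {W : Fin p → ℕ → Ω → ℝ} {ω : Ω}
    (hD : ∀ i, D i ω ≤ r * ∑ j, W j i ω) :
    exceedCount n η D ω ≤ ∑ j, exceedCount n θ (W j) ω := by
  classical
  refine (Finset.card_le_card fun i hi => ?_).trans Finset.card_biUnion_le
  obtain ⟨hi, hlt⟩ := Finset.mem_filter.1 hi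
  simp only [Finset.mem_biUnion, Finset.mem_filter, Finset.mem_univ, true_and]
  by_contra! hcon
  have hsum : ∑ j, W j i ω ≤ p * θ := by
    simpa using Finset.sum_le_card_nsmul Finset.univ (fun j => W j i ω) θ
      fun j _ => hcon j hi
  have := mul_le_mul_of_nonneg_left hsum hr
  linarith [hD i]

end Comparison

section Markov

variable {Ω : Type*} [MeasureSpace Ω] [IsProbabilityMeasure (ℙ : Measure Ω)]

lemma measureReal_le_sum_exceedCount (n p : ℕ) {W : Fin p → ℕ → Ω → ℝ}
    (hW : ∀ j i, Measurable (W j i)) {θ T m : ℝ} (hm : 0 < m)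
    (hT : ∀ j i, (ℙ : Measure Ω).real {ω | θ < W j i ω} ≤ T) :
    (ℙ : Measure Ω).real {ω | m ≤ ∑ j, (exceedCount n θ (W j) ω : ℝ)} ≤ p * (n * T) / m := by
  have hset : ∀ j i, MeasurableSet {ω | θ < W j i ω} := fun j i =>
    measurableSet_lt measurable_const (hW j i)
  have hind : ∀ j i, Integrable ({ω | θ < W j i ω}.indicator fun _ => (1 : ℝ)) (ℙ : Measure Ω) :=
    fun j i => (integrable_const _).indicator (hset j i)
  have hint : ∀ j, Integrable (fun ω => (exceedCount n θ (W j) ω : ℝ)) (ℙ : Measure Ω) := by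
    intro j
    simp only [exceedCount_eq_sum]
    exact integrable_finsetSum _ fun i _ => hind j i
  have hval : ∀ j, ∫ ω, (exceedCount n θ (W j) ω : ℝ) ≤ n * T := by
    intro j
    simp only [exceedCount_eq_sum]
    rw [integral_finsetSum _ fun i _ => hind j i]
    calc ∑ i ∈ Finset.Icc 1 n, ∫ ω, {ω | θ < W j i ω}.indicator (fun _ => (1 : ℝ)) ω
        ≤ ∑ _i ∈ Finset.Icc 1 n, T := by
          refine Finset.sum_le_sum fun i _ => ?_
          rw [integral_indicator_const _ (hset j i), smul_eq_mul, mul_one]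
          exact hT j i
      _ = n * T := by simp
  have hmarkov := mul_meas_ge_le_integral_of_nonneg (μ := (ℙ : Measure Ω))
    (f := fun ω => ∑ j, (exceedCount n θ (W j) ω : ℝ))
    (Eventually.of_forall fun ω => Finset.sum_nonneg fun j _ => Nat.cast_nonneg _)
    (integrable_finsetSum _ fun j _ => hint j) m
  rw [integral_finsetSum _ fun j _ => hint j] at hmarkov
  rw [le_div_iff₀' hm]
  refine hmarkov.trans ((Finset.sum_le_sum fun j _ => hval j).trans ?_)
  simp

end Markov

section Residuals

variable {Ω : Type*} {p : ℕ} {φc : Fin p → ℝ} {X ξ : ℤ → Ω → ℝ}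

lemma abs_Zhat_sub_le
    (hmodel : ∀ (i : ℤ) ω, X i ω = ∑ j : Fin p, φc j * X (i - ((j : ℕ) + 1)) ω + ξ i ω)
    (φh : Ω → Fin p → ℝ) (i : ℕ) (ω : Ω) :
    |Zhat p X φh i ω - (|ξ i ω|)| ≤ ‖(fun j => φh ω j - φc j : Fin p → ℝ)‖
      * ∑ j : Fin p, |X ((i : ℤ) - ((j : ℕ) + 1)) ω| := by
  have h : residual p X φh i ω - ξ i ω
      = -∑ j : Fin p, (φh ω j - φc j) * X ((i : ℤ) - ((j : ℕ) + 1)) ω := by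
    simp only [residual, sub_mul, Finset.sum_sub_distrib]
    linarith [hmodel i ω]
  refine (abs_abs_sub_abs_le _ _).trans ?_
  rw [h, abs_neg, Finset.mul_sum]
  refine (Finset.abs_sum_le_sum_abs _ _).trans (Finset.sum_le_sum fun j _ => ?_)
  rw [abs_mul]
  exact mul_le_mul_of_nonneg_right
    (norm_le_pi_norm (fun j => φh ω j - φc j : Fin p → ℝ) j) (abs_nonneg _)

lemma measurable_Zhat [MeasurableSpace Ω] (hX : ∀ i, Measurable (X i)) {φh : Ω → Fin p → ℝ} (hφ : Measurable φh)
    (i : ℕ) : Measurable (Zhat p X φh i) := by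
  have h : ∀ j, Measurable fun ω => φh ω j := fun j => (measurable_pi_apply j).comp hφ
  refine Measurable.abs ((hX i).sub (Finset.measurable_sum _ fun j _ => ?_))
  exact (h j).mul (hX _)

end Residuals

section Threshold

variable {μ : Measure ℝ} [IsProbabilityMeasure μ] {α : ℝ} {l : ℝ → ℝ}

/-- Thresholds of larger order than `b(n/√k)` are exceeded with probability `o(√k/n)`. -/
lemma ParetoTail.tendsto_tail_of_ratio_atTop (hP : ParetoTail μ α l) (hα : 0 < α) {k : ℕ → ℕ}
    (hk : TailFraction k) {θ : ℕ → ℝ}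
    (hθ : Tendsto (fun n : ℕ => θ n / quantileB μ ((n : ℝ) / Real.sqrt (k n))) atTop atTop) :
    Tendsto (fun n : ℕ => (n : ℝ) / Real.sqrt (k n) * tailDF μ (θ n)) atTop (nhds 0) := by
  have hq := hk.tendsto_div_sqrt
  have hB := (hP.tendsto_quantileB).comp hq
  have hpow : Tendsto (fun M : ℝ => M ^ (-α)) atTop (nhds 0) := tendsto_rpow_neg_atTop hα
  rw [tendsto_order]
  constructor
  · intro a ha
    exact Eventually.of_forall fun n => ha.trans_le
      (mul_nonneg (by positivity) (tailDF_nonneg _ _))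
  · intro ε hε
    obtain ⟨M, hMε, hM⟩ := ((hpow.eventually (gt_mem_nhds hε)).and (eventually_gt_atTop 0)).exists
    have hratio := ((hP.tendsto_ratio hM).comp hB).eventually (gt_mem_nhds hMε)
    filter_upwards [hratio, hθ.eventually (eventually_ge_atTop M),
      hB.eventually (eventually_gt_atTop 0), hq.eventually (eventually_gt_atTop 0)]
      with n h1 h2 h3 h4
    simp only [Function.comp_apply] at h1 h3
    set q := (n : ℝ) / Real.sqrt (k n)
    set B := quantileB μ q
    have hTB : 0 < tailDF μ B := hP.tailDF_pos B
    have h5 : tailDF μ (θ n) ≤ tailDF μ (M * B) := tailDF_antitone μ ((le_div_iff₀ h3).1 h2)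
    have h6 : tailDF μ B ≤ q⁻¹ := tailDF_quantileB_le μ h4
    have h7 : q * tailDF μ B ≤ 1 := by
      calc q * tailDF μ B ≤ q * q⁻¹ := mul_le_mul_of_nonneg_left h6 h4.le
        _ = 1 := mul_inv_cancel₀ h4.ne'
    have h8 : tailDF μ (M * B) < ε * tailDF μ B := (div_lt_iff₀ hTB).1 h1
    nlinarith [mul_le_mul_of_nonneg_left h5 h4.le, mul_lt_mul_of_pos_left h8 h4]

end Threshold

section Negligible

variable {Ω : Type*} [MeasureSpace Ω] [IsProbabilityMeasure (ℙ : Measure Ω)]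
  {p : ℕ} {φc : Fin p → ℝ} {X ξ : ℤ → Ω → ℝ} {α : ℝ} {l : ℝ → ℝ} {k : ℕ → ℕ}
  {φhat : ℕ → Ω → Fin p → ℝ} {d : ℕ → ℝ}

/-- The number of indices at which the residual differs from the error by a fixed multiple of
`b(n/k)/√k` is `o_P(√k)`. -/
lemma tendsto_measureReal_residual_error
    (hXmeas : ∀ i, Measurable (X i))
    (hmodel : ∀ (i : ℤ) ω, X i ω = ∑ j : Fin p, φc j * X (i - ((j : ℕ) + 1)) ω + ξ i ω)
    {μ : Measure ℝ} [IsProbabilityMeasure μ] (hα : 0 < α) (hP : ParetoTail μ α l)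
    (htail : ∃ C c x₀ : ℝ, 0 ≤ C ∧ 0 < c ∧ ∀ i, ∀ x ≥ x₀,
      (ℙ : Measure Ω).real {ω | x < |X i ω|} ≤ C * tailDF μ (c * x))
    (hk : TailFraction k) (hd : Tendsto d atTop atTop)
    (hdb : Tendsto (fun n : ℕ => (Real.sqrt (k n) * quantileB μ ((n : ℝ) / Real.sqrt (k n))
      / quantileB μ ((n : ℝ) / k n)) / d n) atTop (nhds 0))
    (hB4 : BddInProb (fun n ω => d n * ‖(fun j => φhat n ω j - φc j : Fin p → ℝ)‖))
    {ε η : ℝ} (hε : 0 < ε) (hη : 0 < η) :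
    Tendsto (fun n : ℕ => (ℙ : Measure Ω).real {ω | η * Real.sqrt (k n) ≤
      (exceedCount n (ε * (quantileB μ ((n : ℝ) / k n) / Real.sqrt (k n)))
        (fun i ω => |Zhat p X (φhat n) i ω - (|ξ i ω|)|) ω : ℝ)}) atTop (nhds 0) := by
  obtain ⟨C₁, c, x₀, hC₁, hc, htail⟩ := htail
  set b : ℕ → ℝ := fun n => quantileB μ ((n : ℝ) / k n)
  set B : ℕ → ℝ := fun n => quantileB μ ((n : ℝ) / Real.sqrt (k n))
  have hb : Tendsto b atTop atTop := hP.tendsto_quantileB.comp hk.tendsto_div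
  have hB : Tendsto B atTop atTop := hP.tendsto_quantileB.comp hk.tendsto_div_sqrt
  rw [tendsto_order]
  refine ⟨fun a ha => Eventually.of_forall fun n => ha.trans_le measureReal_nonneg,
    fun τ hτ => ?_⟩
  obtain ⟨C₀, hC₀⟩ := hB4 (τ / 2) (by linarith)
  set C := max C₀ 1
  have hC : 0 < C := lt_max_of_lt_right one_pos
  set e : ℝ := ε / (C * (p + 1))
  have he : 0 < e := by positivity
  set θ : ℕ → ℝ := fun n => e * (d n * (b n / Real.sqrt (k n)))
  have hD : Tendsto (fun n => d n * (b n / Real.sqrt (k n)) / B n) atTop atTop := by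
    have h0 : Tendsto (fun n : ℕ => (Real.sqrt (k n) * B n / b n) / d n) atTop
        (nhdsWithin 0 (Ioi 0)) := by
      refine tendsto_nhdsWithin_iff.2 ⟨hdb, ?_⟩
      filter_upwards [hb.eventually (eventually_gt_atTop 0), hB.eventually (eventually_gt_atTop 0),
        hd.eventually (eventually_gt_atTop 0), hk.tendsto_sqrt.eventually (eventually_gt_atTop 0)]
        with n h1 h2 h3 h4
      exact div_pos (div_pos (mul_pos h4 h2) h1) h3
    refine h0.inv_tendsto_nhdsGT_zero.congr fun n => ?_
    simp only [Pi.inv_apply]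
    rw [inv_div, div_div_eq_mul_div, mul_div_assoc', div_div]
  have hθB : ∀ {a : ℝ}, 0 < a → Tendsto (fun n => a * θ n / B n) atTop atTop := by
    intro a ha
    refine (hD.const_mul_atTop (mul_pos ha he)).congr fun n => ?_
    simp only [θ]
    ring
  have hθ : Tendsto θ atTop atTop := by
    refine tendsto_atTop_mono' _ ?_ hB
    filter_upwards [(hθB one_pos).eventually (eventually_ge_atTop 1),
      hB.eventually (eventually_gt_atTop 0)] with n h1 h2
    rw [le_div_iff₀ h2] at h1
    linarith
  have hsmall : Tendsto (fun n : ℕ => p * (n * (C₁ * tailDF μ (c * θ n)))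
      / (η * Real.sqrt (k n))) atTop (nhds 0) := by
    have := (hP.tendsto_tail_of_ratio_atTop hα hk (θ := fun n => c * θ n) (hθB hc)).const_mul
      (p * C₁ / η)
    rw [mul_zero] at this
    refine this.congr fun n => ?_
    rw [div_mul_eq_mul_div, div_mul_eq_mul_div, mul_div_assoc', div_div, mul_comm (Real.sqrt _)]
    ring
  filter_upwards [hsmall.eventually (gt_mem_nhds (half_pos hτ)), hC₀,
    hθ.eventually (eventually_ge_atTop x₀), hd.eventually (eventually_gt_atTop 0),
    hk.tendsto_sqrt.eventually (eventually_gt_atTop 0), hb.eventually (eventually_gt_atTop 0)]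
    with n h1 h2 h3 h4 h5 h6
  set W : Fin p → ℕ → Ω → ℝ := fun j i ω => |X ((i : ℤ) - ((j : ℕ) + 1)) ω|
  have hmark := measureReal_le_sum_exceedCount (Ω := Ω) n p (W := W)
    (fun j i => (hXmeas _).abs) (mul_pos hη h5) (fun j i => htail _ _ h3)
  refine (measureReal_mono (s₂ := {ω | C₀ < |d n * ‖(fun j => φhat n ω j - φc j : Fin p → ℝ)‖|}
    ∪ {ω | η * Real.sqrt (k n) ≤ ∑ j, (exceedCount n (θ n) (W j) ω : ℝ)}) ?_
    (measure_ne_top _ _)).trans_lt ((measureReal_union_le _ _).trans_lt ?_)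
  · intro ω hω
    by_cases hω1 : C₀ < |d n * ‖(fun j => φhat n ω j - φc j : Fin p → ℝ)‖|
    · exact Or.inl hω1
    right
    set r := ‖(fun j => φhat n ω j - φc j : Fin p → ℝ)‖ with hr
    have hdr : d n * r ≤ C := (le_abs_self _).trans ((not_lt.1 hω1).trans (le_max_left _ _))
    have hbk : 0 < b n / Real.sqrt (k n) := div_pos h6 h5
    have hθr : r * (p * θ n) ≤ ε * (b n / Real.sqrt (k n)) := by
      have hCe : C * (p * e) ≤ ε := by
        have : C * (p * e) = ε * (p / (p + 1)) := by
          simp only [e]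
          field_simp
        rw [this]
        refine mul_le_of_le_one_right hε.le ((div_le_one (by positivity)).2 (by linarith))
      calc r * (p * θ n) = (d n * r) * (p * e) * (b n / Real.sqrt (k n)) := by
            simp only [θ]
            ring
        _ ≤ C * (p * e) * (b n / Real.sqrt (k n)) := by gcongr
        _ ≤ ε * (b n / Real.sqrt (k n)) := by gcongr
    have hcount := exceedCount_le_sum n p (norm_nonneg _) hθr
      (D := fun i ω => |Zhat p X (φhat n) i ω - (|ξ i ω|)|) (W := W) (ω := ω)
      fun i => abs_Zhat_sub_le hmodel (φhat n) i ω
    have hω' : η * Real.sqrt (k n) ≤ (exceedCount n (ε * (b n / Real.sqrt (k n)))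
        (fun i ω => |Zhat p X (φhat n) i ω - (|ξ i ω|)|) ω : ℝ) := hω
    exact hω'.trans (by exact_mod_cast hcount)
  · have h2' : (ℙ : Measure Ω).real
        {ω | C₀ < |d n * ‖(fun j => φhat n ω j - φc j : Fin p → ℝ)‖|} < τ / 2 := h2
    linarith

end Negligible

/-- Thresholds `b exp(t/s)` with distinct parameters are separated at the scale `b/s`. -/
lemma add_le_mul_exp {b s t u : ℝ} (hb : 0 ≤ b) (hs : 0 < s) (htu : t ≤ u)
    (ht : 1 / 2 ≤ Real.exp (t / s)) :
    b * Real.exp (t / s) + (u - t) / 2 * (b / s) ≤ b * Real.exp (u / s) := by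
  have h1 : Real.exp (u / s) = Real.exp (t / s) * Real.exp ((u - t) / s) := by
    rw [← Real.exp_add]
    congr 1
    ring
  have h2 := Real.add_one_le_exp ((u - t) / s)
  have h3 : 0 ≤ (u - t) / s := div_nonneg (by linarith) hs.le
  have h4 : Real.exp (t / s) + (u - t) / s / 2 ≤ Real.exp (u / s) := by
    rw [h1]
    nlinarith [mul_le_mul_of_nonneg_left h2 (Real.exp_pos (t / s)).le]
  calc b * Real.exp (t / s) + (u - t) / 2 * (b / s)
      = b * (Real.exp (t / s) + (u - t) / s / 2) := by ring
    _ ≤ b * Real.exp (u / s) := mul_le_mul_of_nonneg_left h4 hb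

/-- A perturbation of counts that is `o_P(√k)` does not alter their distributional limit. -/
lemma tendsto_measureReal_exceedCount_perturb {Ω : Type*} [MeasureSpace Ω]
    [IsProbabilityMeasure (ℙ : Measure Ω)] {Y : ℕ → Ω → ℝ} {Y' : ℕ → ℕ → Ω → ℝ}
    {k : ℕ → ℕ} (hk : TailFraction k) {b : ℕ → ℝ} (hb : Tendsto b atTop atTop) {α : ℝ}
    {Φ : ℝ → ℝ} (hΦ : Continuous Φ)
    (hY : ∀ s δ, Tendsto (fun n : ℕ => (ℙ : Measure Ω).real
      {ω | (exceedCount n (b n * Real.exp (s / Real.sqrt (k n))) Y ω : ℝ)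
        < k n - δ * Real.sqrt (k n)}) atTop (nhds (Φ (α * s - δ))))
    (herr : ∀ ε η : ℝ, 0 < ε → 0 < η → Tendsto (fun n : ℕ => (ℙ : Measure Ω).real
      {ω | η * Real.sqrt (k n) ≤ (exceedCount n (ε * (b n / Real.sqrt (k n)))
        (fun i ω => |Y' n i ω - Y i ω|) ω : ℝ)}) atTop (nhds 0)) (t : ℝ) :
    Tendsto (fun n : ℕ => (ℙ : Measure Ω).real
      {ω | exceedCount n (b n * Real.exp (t / Real.sqrt (k n))) (Y' n) ω < k n}) atTop
      (nhds (Φ (α * t))) := by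
  have hexp : ∀ s : ℝ, ∀ᶠ n : ℕ in atTop, 1 / 2 ≤ Real.exp (s / Real.sqrt (k n)) := by
    intro s
    have h0 : Tendsto (fun n : ℕ => Real.exp (s / Real.sqrt (k n))) atTop (nhds 1) := by
      have := (Real.continuous_exp.tendsto 0).comp (hk.tendsto_sqrt.const_div_atTop s)
      rwa [Real.exp_zero] at this
    exact (h0.eventually (lt_mem_nhds (show (1 / 2 : ℝ) < 1 by norm_num))).mono fun n h => h.le
  rw [tendsto_order]
  constructor
  · intro a ha
    have hlow : Tendsto (fun ε : ℝ => Φ (α * (t - ε) - ε)) (nhdsWithin 0 (Ioi 0))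
        (nhds (Φ (α * t))) := by
      have : Continuous fun ε : ℝ => Φ (α * (t - ε) - ε) := by fun_prop
      simpa using (this.tendsto 0).mono_left nhdsWithin_le_nhds
    obtain ⟨ε, hεa, hε⟩ := ((hlow.eventually (lt_mem_nhds ha)).and self_mem_nhdsWithin).exists
    have hε0 : 0 < ε := hε
    have hdiff := (hY (t - ε) ε).sub (herr (ε / 2) ε (half_pos hε0) hε0)
    rw [sub_zero] at hdiff
    filter_upwards [hdiff.eventually (lt_mem_nhds hεa), hexp (t - ε),
      hb.eventually (eventually_ge_atTop 0), hk.tendsto_sqrt.eventually (eventually_gt_atTop 0)]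
      with n h1 h2 h3 h4
    refine h1.trans_le (sub_le_iff_le_add.2 ((measureReal_mono ?_ (measure_ne_top _ _)).trans
      (measureReal_union_le _ _)))
    intro ω hω
    have hω' : (exceedCount n (b n * Real.exp ((t - ε) / Real.sqrt (k n))) Y ω : ℝ)
        < k n - ε * Real.sqrt (k n) := hω
    by_cases hR : ε * Real.sqrt (k n) ≤ (exceedCount n (ε / 2 * (b n / Real.sqrt (k n)))
        (fun i ω => |Y' n i ω - Y i ω|) ω : ℝ)
    · exact Or.inr hR
    left
    have hsep := add_le_mul_exp h3 h4 (show t - ε ≤ t by linarith) h2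
    rw [sub_sub_cancel] at hsep
    have hc := exceedCount_le_add n hsep Y (Y' n) ω
    have hc' : (exceedCount n (b n * Real.exp (t / Real.sqrt (k n))) (Y' n) ω : ℝ)
        ≤ exceedCount n (b n * Real.exp ((t - ε) / Real.sqrt (k n))) Y ω
          + exceedCount n (ε / 2 * (b n / Real.sqrt (k n))) (fun i ω => |Y' n i ω - Y i ω|) ω := by
      exact_mod_cast hc
    have : (exceedCount n (b n * Real.exp (t / Real.sqrt (k n))) (Y' n) ω : ℝ) < k n := by linarith
    exact Nat.cast_lt.1 this
  · intro a ha
    have hup : Tendsto (fun ε : ℝ => Φ (α * (t + ε) - -ε)) (nhdsWithin 0 (Ioi 0))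
        (nhds (Φ (α * t))) := by
      have : Continuous fun ε : ℝ => Φ (α * (t + ε) - -ε) := by fun_prop
      simpa using (this.tendsto 0).mono_left nhdsWithin_le_nhds
    obtain ⟨ε, hεa, hε⟩ := ((hup.eventually (gt_mem_nhds ha)).and self_mem_nhdsWithin).exists
    have hε0 : 0 < ε := hε
    have hsum := (hY (t + ε) (-ε)).add (herr (ε / 2) ε (half_pos hε0) hε0)
    rw [add_zero] at hsum
    filter_upwards [hsum.eventually (gt_mem_nhds hεa), hexp t,
      hb.eventually (eventually_ge_atTop 0), hk.tendsto_sqrt.eventually (eventually_gt_atTop 0)]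
      with n h1 h2 h3 h4
    refine ((measureReal_mono ?_ (measure_ne_top _ _)).trans (measureReal_union_le _ _)).trans_lt h1
    intro ω hω
    have hω' : (exceedCount n (b n * Real.exp (t / Real.sqrt (k n))) (Y' n) ω : ℝ) < k n :=
      Nat.cast_lt.2 hω
    by_cases hR : ε * Real.sqrt (k n) ≤ (exceedCount n (ε / 2 * (b n / Real.sqrt (k n)))
        (fun i ω => |Y' n i ω - Y i ω|) ω : ℝ)
    · exact Or.inr hR
    left
    have hsep := add_le_mul_exp h3 h4 (show t ≤ t + ε by linarith) h2
    rw [add_sub_cancel_left] at hsep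
    have hc := exceedCount_le_add n hsep (Y' n) Y ω
    have hc' : (exceedCount n (b n * Real.exp ((t + ε) / Real.sqrt (k n))) Y ω : ℝ)
        ≤ exceedCount n (b n * Real.exp (t / Real.sqrt (k n))) (Y' n) ω
          + exceedCount n (ε / 2 * (b n / Real.sqrt (k n))) (fun i ω => |Y' n i ω - Y i ω|) ω := by
      have h5 : (fun i ω => |Y i ω - Y' n i ω|) = fun i ω => |Y' n i ω - Y i ω| := by
        funext i ω
        exact abs_sub_comm _ _
      rw [h5] at hc
      exact_mod_cast hc
    show (exceedCount n (b n * Real.exp ((t + ε) / Real.sqrt (k n))) Y ω : ℝ)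
      < k n - -ε * Real.sqrt (k n)
    linarith

/-- Logarithmic spacings of an order statistic converge in law as soon as the order statistic
itself has the right asymptotic position relative to the thresholds `b exp(t/√k)`. -/
lemma tendsto_measureReal_log_spacing_le {Ω : Type*} [MeasureSpace Ω]
    [IsProbabilityMeasure (ℙ : Measure Ω)] {O : ℕ → Ω → ℝ} {s b : ℕ → ℝ}
    (hs : Tendsto s atTop atTop) (hb : Tendsto b atTop atTop) {F : ℝ → ℝ}
    (hF : Tendsto F atBot (nhds 0))
    (hO : ∀ t, Tendsto (fun n => (ℙ : Measure Ω).real {ω | O n ω ≤ b n * Real.exp (t / s n)})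
      atTop (nhds (F t))) (t : ℝ) :
    Tendsto (fun n => (ℙ : Measure Ω).real
      {ω | s n * (Real.log (O n ω) - Real.log (b n)) ≤ t}) atTop (nhds (F t)) := by
  have hzero : Tendsto (fun n => (ℙ : Measure Ω).real {ω | O n ω ≤ 0}) atTop (nhds 0) := by
    rw [tendsto_order]
    refine ⟨fun a ha => Eventually.of_forall fun n => ha.trans_le measureReal_nonneg,
      fun ε hε => ?_⟩
    obtain ⟨u, hu⟩ := (hF.eventually (gt_mem_nhds hε)).exists
    filter_upwards [(hO u).eventually (gt_mem_nhds hu), hb.eventually (eventually_ge_atTop 0)]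
      with n h1 h2
    refine (measureReal_mono (fun ω hω => ?_) (measure_ne_top _ _)).trans_lt h1
    exact le_trans hω (mul_nonneg h2 (Real.exp_pos _).le)
  have key : ∀ᶠ n in atTop, ∀ ω, 0 < O n ω →
      (s n * (Real.log (O n ω) - Real.log (b n)) ≤ t ↔ O n ω ≤ b n * Real.exp (t / s n)) := by
    filter_upwards [hs.eventually (eventually_gt_atTop 0), hb.eventually (eventually_gt_atTop 0)]
      with n h1 h2 ω hω
    rw [← le_div_iff₀' h1, sub_le_iff_le_add, Real.log_le_iff_le_exp hω, Real.exp_add,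
      Real.exp_log h2, mul_comm]
  have hlow := (hO t).sub hzero
  have hup := (hO t).add hzero
  rw [sub_zero] at hlow
  rw [add_zero] at hup
  refine tendsto_of_tendsto_of_tendsto_of_le_of_le' hlow hup ?_ ?_
  · filter_upwards [key] with n hn
    refine sub_le_iff_le_add.2 ((measureReal_mono (fun ω hω => ?_) (measure_ne_top _ _)).trans
      (measureReal_union_le _ _))
    rcases le_or_gt (O n ω) 0 with h | h
    · exact Or.inr h
    · exact Or.inl ((hn ω h).2 hω)
  · filter_upwards [key] with n hn
    refine (measureReal_mono (fun ω hω => ?_) (measure_ne_top _ _)).trans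
      (measureReal_union_le _ _)
    rcases le_or_gt (O n ω) 0 with h | h
    · exact Or.inr h
    · exact Or.inl ((hn ω h).1 hω)

/-- Under (B1)–(B4), `√k (log Ẑ_(k) - log b*(n/k)) ⇒ N(0, α⁻²)`. -/
theorem residual_order_stat_log_spacing_gaussian
    {Ω : Type*} [MeasureSpace Ω] [IsProbabilityMeasure (ℙ : Measure Ω)]
    (p : ℕ) (φc : Fin p → ℝ) (X ξ : ℤ → Ω → ℝ)
    (hXmeas : ∀ i, Measurable (X i)) (hξmeas : ∀ i, Measurable (ξ i))
    (hmodel : ∀ (i : ℤ) ω, X i ω = ∑ j : Fin p, φc j * X (i - ((j : ℕ) + 1)) ω + ξ i ω)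
    (hchar : ∀ z : ℂ, ‖z‖ < 1 →
      (1 : ℂ) - ∑ j : Fin p, (φc j : ℂ) * z ^ ((j : ℕ) + 1) ≠ 0)
    (hstat : IsStationaryZ X)
    (hindep : iIndepFun (m := fun _ : ℤ => Real.measurableSpace) ξ (ℙ : Measure Ω))
    (hident : ∀ i : ℤ, Measure.map (ξ i) (ℙ : Measure Ω) = Measure.map (ξ 1) (ℙ : Measure Ω))
    (α : ℝ) (hα : 0 < α) (lstar : ℝ → ℝ)
    (hB1 : ParetoTail (Measure.map (fun ω => |ξ 1 ω|) (ℙ : Measure Ω)) α lstar)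
    (g : ℝ → ℝ) (Kκ γ : ℝ) (hB2 : SecondOrderRV lstar g Kκ γ)
    (k : ℕ → ℕ) (hk : TailFraction k)
    (hB3 : Tendsto (fun n : ℕ => Real.sqrt (k n) * g ((quantileB (Measure.map (fun ω => |ξ 1 ω|) (ℙ : Measure Ω))) ((n : ℝ) / k n)))
      atTop (nhds 0))
    (φhat : ℕ → Ω → Fin p → ℝ) (hφhat : ∀ n, Measurable (φhat n))
    (d : ℕ → ℝ) (hd : Tendsto d atTop atTop)
    (hdb : Tendsto (fun n : ℕ =>
        (Real.sqrt (k n) * (quantileB (Measure.map (fun ω => |ξ 1 ω|) (ℙ : Measure Ω))) ((n : ℝ) / Real.sqrt (k n)) / (quantileB (Measure.map (fun ω => |ξ 1 ω|) (ℙ : Measure Ω))) ((n : ℝ) / k n)) / d n)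
      atTop (nhds 0))
    (hB4 : BddInProb (fun n ω => d n * ‖(fun j => φhat n ω j - φc j : Fin p → ℝ)‖)) :
    TendstoInLaw
      (fun n ω => Real.sqrt (k n) *
        (Real.log (orderStat n (k n) (Zhat p X (φhat n)) ω)
          - Real.log ((quantileB (Measure.map (fun ω => |ξ 1 ω|) (ℙ : Measure Ω))) ((n : ℝ) / k n))))
      (gaussianReal 0 (Real.toNNReal (α⁻¹ ^ 2))) := by
  set μ := Measure.map (fun ω => |ξ 1 ω|) (ℙ : Measure Ω) with hμdef
  have hμ : IsProbabilityMeasure μ := Measure.isProbabilityMeasure_map (hξmeas 1).abs.aemeasurable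
  have hμ0 : μ (Iio 0) = 0 := by
    rw [hμdef, Measure.map_apply (hξmeas 1).abs measurableSet_Iio]
    have : (fun ω => |ξ 1 ω|) ⁻¹' Iio 0 = ∅ :=
      eq_empty_of_forall_notMem fun ω hω => (abs_nonneg (ξ 1 ω)).not_gt hω
    rw [this, measure_empty]
  set b : ℕ → ℝ := fun n => quantileB μ ((n : ℝ) / k n)
  have hb : Tendsto b atTop atTop := hB1.tendsto_quantileB.comp hk.tendsto_div
  have hYind : iIndepFun (m := fun _ : ℕ => Real.measurableSpace)
      (fun (i : ℕ) ω => |ξ (i : ℤ) ω|) (ℙ : Measure Ω) :=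
    (hindep.precomp Nat.cast_injective).comp (fun _ x => |x|) fun _ => measurable_id.abs
  have hcount := fun t : ℝ => tendsto_measureReal_exceedCount_perturb (Ω := Ω)
    (Y := fun i ω => |ξ (i : ℤ) ω|) (Y' := fun n => Zhat p X (φhat n)) hk hb (α := α)
    (continuous_cdf_gaussianReal 0 one_ne_zero)
    (fun s δ => by
      have := tendsto_measureReal_exceedCount (Ω := Ω) (fun i : ℕ => (hξmeas (i : ℤ)).abs) hYind
        (T := tailDF μ) (fun i c => measureReal_abs_eq hξmeas hident i c) hk
        (SecondOrderRV.tendsto_tail_quantileB hα hB1 hB2 hμ0 hk hB3 s) δ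
      rwa [neg_neg] at this)
    (fun ε η hε hη => tendsto_measureReal_residual_error hXmeas hmodel hα hB1
      (exists_tail_bound hXmeas hξmeas hmodel hchar hstat hindep hident hα hB1) hk hd hdb hB4
      hε hη) t
  have hZ : ∀ n i, Measurable (Zhat p X (φhat n) i) := fun n =>
    measurable_Zhat hXmeas (hφhat n)
  refine tendstoInLaw_of_tendsto_cdf (fun n => ?_) _ fun t => ?_
  · exact ((Real.measurable_log.comp (measurable_orderStat n (k n) (hZ n))).sub_const _).const_mul _
  refine tendsto_measureReal_log_spacing_le hk.tendsto_sqrt hb (tendsto_cdf_atBot _) (fun u => ?_) t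
  rw [cdf_gaussianReal_inv_sq hα]
  refine (hcount u).congr' ?_
  have hkn : ∀ᶠ n : ℕ in atTop, 0 < k n ∧ k n ≤ n := by
    filter_upwards [hk.1.eventually (eventually_gt_atTop 0),
      hk.2.eventually (gt_mem_nhds one_pos), eventually_gt_atTop 0] with n h1 h2 h3
    have h3' : (0 : ℝ) < n := by exact_mod_cast h3
    rw [div_lt_one h3'] at h2
    exact ⟨by exact_mod_cast h1, by exact_mod_cast h2.le⟩
  filter_upwards [hkn] with n hn
  simp only [orderStat_le_iff hn.1 hn.2]

end TailCusum
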